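/- Let k be an infinite cardinal and let X be an absolute F_σδ-set of first category such that Ind X = 0, X is nowhere σLW(<k) + 𝒢_δσ, and the weight of X equals k. Then X is homeomorphic to Q(k)^ω. -/

import Mathlib

open Topology Set Filter

universe u v

noncomputable section

/-- Strong zero-dimensionality (`Ind X = 0`): any two disjoint closed sets
can be separated by a clopen set. -/
def StronglyZeroDim (X : Type*) [TopologicalSpace X] : Prop :=
  ∀ A B : Set X, IsClosed A → IsClosed B → Disjoint A B →
    ∃ U : Set X, IsClopen U ∧ A ⊆ U ∧ Disjoint B U

/-- The topological weight of a space: the least cardinality of a base. -/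
def topWeight (X : Type u) [TopologicalSpace X] : Cardinal.{u} :=
  ⨅ B : {B : Set (Set X) // TopologicalSpace.IsTopologicalBasis B}, Cardinal.mk B.1

/-- The space has a base of cardinality `< k`. -/
def WeightLT (X : Type u) [TopologicalSpace X] (k : Cardinal.{u}) : Prop :=
  ∃ B : Set (Set X), TopologicalSpace.IsTopologicalBasis B ∧ Cardinal.mk B < k

/-- Every point has a neighborhood of weight `< k`. -/
def LocallyWeightLT (X : Type u) [TopologicalSpace X] (k : Cardinal.{u}) : Prop :=
  ∀ x : X, ∃ s : Set X, s ∈ nhds x ∧ WeightLT ↥s k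

/-- `X ∈ σLW(<k)`: `X` is a countable union of subspaces, each locally of weight `< k`. -/
def SigmaLW (X : Type u) [TopologicalSpace X] (k : Cardinal.{u}) : Prop :=
  ∃ S : ℕ → Set X, (⋃ n, S n) = Set.univ ∧ ∀ n, LocallyWeightLT ↥(S n) k

/-- A `G_δσ`-subset: a countable union of `G_δ`-sets. -/
def IsGdeltaSigma {Y : Type*} [TopologicalSpace Y] (s : Set Y) : Prop :=
  ∃ G : ℕ → Set Y, (∀ n, IsGδ (G n)) ∧ s = ⋃ n, G n

/-- An `F_σ`-subset: a countable union of closed sets. -/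
def IsFsigmaSet {Y : Type*} [TopologicalSpace Y] (s : Set Y) : Prop :=
  ∃ F : ℕ → Set Y, (∀ n, IsClosed (F n)) ∧ s = ⋃ n, F n

/-- An `F_σδ`-subset: a countable intersection of `F_σ`-sets. -/
def IsFsigmaDelta {Y : Type*} [TopologicalSpace Y] (s : Set Y) : Prop :=
  ∃ F : ℕ → Set Y, (∀ n, IsFsigmaSet (F n)) ∧ s = ⋂ n, F n

/-- An absolute `G_δσ`-set: a metrizable space whose image under every embedding
into a metrizable space is a countable union of `G_δ`-sets. -/
def AbsGdeltaSigma (X : Type u) [TopologicalSpace X] : Prop :=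
  TopologicalSpace.MetrizableSpace X ∧
    ∀ (Y : Type u) [TopologicalSpace Y] [TopologicalSpace.MetrizableSpace Y]
      (f : X → Y), Topology.IsEmbedding f → IsGdeltaSigma (Set.range f)

/-- An absolute `F_σδ`-set: a metrizable space whose image under every embedding
into a metrizable space is an `F_σδ`-set. -/
def AbsFsigmaDelta (X : Type u) [TopologicalSpace X] : Prop :=
  TopologicalSpace.MetrizableSpace X ∧
    ∀ (Y : Type u) [TopologicalSpace Y] [TopologicalSpace.MetrizableSpace Y]
      (f : X → Y), Topology.IsEmbedding f → IsFsigmaDelta (Set.range f)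

/-- `X ∈ σLW(<k) + 𝒢_δσ` : `X = A ∪ B` with `A ∈ σLW(<k)` and `B` an absolute
`G_δσ`-set. -/
def SLWplusGDS (X : Type u) [TopologicalSpace X] (k : Cardinal.{u}) : Prop :=
  ∃ A B : Set X, A ∪ B = Set.univ ∧ SigmaLW ↥A k ∧ AbsGdeltaSigma ↥B

/-- No nonempty open subspace is `σLW(<k) + 𝒢_δσ`. -/
def NowhereSLWplusGDS (X : Type u) [TopologicalSpace X] (k : Cardinal.{u}) : Prop :=
  ∀ U : Set X, IsOpen U → U.Nonempty → ¬ SLWplusGDS ↥U k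

/-- A space is of first category if it is meager in itself. -/
def FirstCategory (X : Type*) [TopologicalSpace X] : Prop :=
  IsMeagre (Set.univ : Set X)

/-- A Souslin (analytic) subset of a space:
`s = ⋃_{t ∈ ω^ω} ⋂_n F(t↾n)` for a family of closed sets indexed by finite tuples. -/
def IsSuslinIn {Y : Type*} [TopologicalSpace Y] (s : Set Y) : Prop :=
  ∃ F : List ℕ → Set Y, (∀ l, IsClosed (F l)) ∧
    s = ⋃ t : ℕ → ℕ, ⋂ n : ℕ, F (List.ofFn fun i : Fin n => t i)

/-- An absolute Souslin space: metrizable, and Souslin in every completely metrizable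
space into which it embeds. -/
def AbsSuslin (X : Type u) [TopologicalSpace X] : Prop :=
  TopologicalSpace.MetrizableSpace X ∧
    ∀ (Y : Type u) [MetricSpace Y] [CompleteSpace Y] (f : X → Y),
      Topology.IsEmbedding f → IsSuslinIn (Set.range f)

/-- An h-homogeneous space: every nonempty clopen subset is homeomorphic to the
whole space. -/
def HHomogeneous (X : Type*) [TopologicalSpace X] : Prop :=
  ∀ U : Set X, IsClopen U → U.Nonempty → Nonempty (↥U ≃ₜ X)

/-- A discrete family of sets: every point has a neighborhood meeting at most one
member of the family. -/
def DiscreteFamily {X : Type*} [TopologicalSpace X] {ι : Type*} (f : ι → Set X) : Prop :=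
  ∀ x : X, ∃ U ∈ nhds x, {i | (f i ∩ U).Nonempty}.Subsingleton

/-- A discrete space of cardinality `k`. -/
def DiscT (k : Cardinal.{u}) : Type u := k.out

instance (k : Cardinal.{u}) : TopologicalSpace (DiscT k) := ⊥
instance (k : Cardinal.{u}) : DiscreteTopology (DiscT k) := ⟨rfl⟩

/-- The Baire space `B(k) = k^ω`. -/
def BaireB (k : Cardinal.{u}) : Type u := ℕ → DiscT k

instance (k : Cardinal.{u}) : TopologicalSpace (BaireB k) :=
  inferInstanceAs (TopologicalSpace (ℕ → DiscT k))

open Classical in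
/-- The discrete factor of `B*(k)`: two points if `k = ℵ₀`, and `k` points otherwise. -/
def StarT (k : Cardinal.{u}) : Type u :=
  if k = Cardinal.aleph0 then ULift Bool else DiscT k

instance (k : Cardinal.{u}) : TopologicalSpace (StarT k) := ⊥
instance (k : Cardinal.{u}) : DiscreteTopology (StarT k) := ⟨rfl⟩

/-- `B*(k)`: the Cantor set `2^ω` if `k = ℵ₀`, and the Baire space `B(k)` if `k > ℵ₀`. -/
def BaireStar (k : Cardinal.{u}) : Type u := ℕ → StarT k

instance (k : Cardinal.{u}) : TopologicalSpace (BaireStar k) :=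
  inferInstanceAs (TopologicalSpace (ℕ → StarT k))

/-- A discrete space of cardinality `k` (for infinite `k`), with a distinguished basepoint. -/
def QBase (k : Cardinal.{u}) : Type u := DiscT k ⊕ PUnit.{u + 1}

instance (k : Cardinal.{u}) : TopologicalSpace (QBase k) := ⊥
instance (k : Cardinal.{u}) : DiscreteTopology (QBase k) := ⟨rfl⟩

/-- `Q(k)`: the σ-product of `ω` copies of a discrete space of cardinality `k`, i.e.
the subspace of the product consisting of the sequences eventually equal to the basepoint. -/
def Qk (k : Cardinal.{u}) : Type u :=
  {x : ℕ → QBase k // ∀ᶠ n in Filter.atTop, x n = Sum.inr PUnit.unit}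

instance (k : Cardinal.{u}) : TopologicalSpace (Qk k) :=
  inferInstanceAs (TopologicalSpace
    {x : ℕ → QBase k // ∀ᶠ n in Filter.atTop, x n = Sum.inr PUnit.unit})

/-- The countable power `Q(k)^ω`. -/
def QkOmega (k : Cardinal.{u}) : Type u := ℕ → Qk k

instance (k : Cardinal.{u}) : TopologicalSpace (QkOmega k) :=
  inferInstanceAs (TopologicalSpace (ℕ → Qk k))

/-- `Z` is homeomorphic to `Q(k)^ω`. -/
def IsQkOmega (k : Cardinal.{u}) (Z : Type*) [TopologicalSpace Z] : Prop :=
  Nonempty (Z ≃ₜ QkOmega k)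

/-- `Z` is homeomorphic to `A^{II}_k`, the complement in `B*(k)` of a dense copy of
`Q(k)^ω`. -/
def IsAII (k : Cardinal.{u}) (Z : Type*) [TopologicalSpace Z] : Prop :=
  ∃ A : Set (BaireStar k), Dense A ∧ IsQkOmega k ↥A ∧ Nonempty (Z ≃ₜ ↥(Aᶜ))

/-- `Z` is homeomorphic to `A^I_k = Q × A^{II}_k`. -/
def IsAI (k : Cardinal.{u}) (Z : Type*) [TopologicalSpace Z] : Prop :=
  ∃ A : Set (BaireStar k), Dense A ∧ IsQkOmega k ↥A ∧ Nonempty (Z ≃ₜ (ℚ × ↥(Aᶜ)))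

/-- `Z` is homeomorphic to `M^{II}_k`, the complement in `B*(k)` of a dense copy of
`A^I_k`. -/
def IsMII (k : Cardinal.{u}) (Z : Type*) [TopologicalSpace Z] : Prop :=
  ∃ Y : Set (BaireStar k), Dense Y ∧ IsAI k ↥Y ∧ Nonempty (Z ≃ₜ ↥(Yᶜ))

/-- `X ∈ 𝓕_σδ ∖ σLW(<k)`: `X` is homeomorphic to `F ∖ L` for some absolute
`F_σδ`-space `F` and some `L ⊆ F` with `L ∈ σLW(<k)`. -/
def FsdMinusSLW (X : Type u) [TopologicalSpace X] (k : Cardinal.{u}) : Prop :=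
  ∃ (F : TopCat.{u}) (L : Set F), AbsFsigmaDelta ↥F ∧ SigmaLW ↥L k ∧
    Nonempty (X ≃ₜ ↥(Lᶜ))

/-- No nonempty open subspace is in the class `𝓕_σδ ∖ σLW(<k)`. -/
def NowhereFsdMinusSLW (X : Type u) [TopologicalSpace X] (k : Cardinal.{u}) : Prop :=
  ∀ U : Set X, IsOpen U → U.Nonempty → ¬ FsdMinusSLW ↥U k

/-- A topologically complete (i.e. completely metrizable) space. -/
def CompletelyMetrizable (X : Type*) [t : TopologicalSpace X] : Prop :=
  ∃ m : MetricSpace X, m.toUniformSpace.toTopologicalSpace = t ∧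
    @CompleteSpace X m.toUniformSpace

end
set_option linter.unusedSectionVars false

namespace QKO

variable {I : Type u}

/-- The cylinder of sequences which agree with `x` below `n`. -/
def cy (x : ℕ → I) (n : ℕ) : Set (ℕ → I) := {y | ∀ i < n, y i = x i}

theorem self_mem_cy (x : ℕ → I) (n : ℕ) : x ∈ cy x n := fun _ _ => rfl

theorem cy_anti (x : ℕ → I) {n m : ℕ} (h : n ≤ m) : cy x m ⊆ cy x n :=
  fun _ hy i hi => hy i (lt_of_lt_of_le hi h)

theorem cy_eq {x y : ℕ → I} {n : ℕ} (h : y ∈ cy x n) : cy y n = cy x n := by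
  ext z
  constructor
  · intro hz i hi
    rw [hz i hi, h i hi]
  · intro hz i hi
    rw [hz i hi, h i hi]

theorem cy_eq_of_le {x y : ℕ → I} {n m : ℕ} (h : y ∈ cy x m) (hn : n ≤ m) : cy y n = cy x n :=
  cy_eq (cy_anti x hn h)

theorem mem_cy_symm {x y : ℕ → I} {n : ℕ} (h : y ∈ cy x n) : x ∈ cy y n :=
  fun i hi => (h i hi).symm

theorem mem_cy_of_eq {x y : ℕ → I} {n : ℕ} (h : cy y n = cy x n) : y ∈ cy x n :=
  h ▸ self_mem_cy y n

variable [TopologicalSpace I] [DiscreteTopology I]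

theorem isOpen_cy (x : ℕ → I) (n : ℕ) : IsOpen (cy x n) := by
  have : cy x n = ⋂ i ∈ Finset.range n, (fun y : ℕ → I => y i) ⁻¹' {x i} := by
    ext y; simp [cy]
  rw [this]
  exact isOpen_biInter_finset fun i _ => (isOpen_discrete _).preimage (continuous_apply i)

theorem isClosed_cy (x : ℕ → I) (n : ℕ) : IsClosed (cy x n) := by
  have : cy x n = ⋂ i ∈ Finset.range n, (fun y : ℕ → I => y i) ⁻¹' {x i} := by
    ext y; simp [cy]
  rw [this]
  exact isClosed_biInter fun i _ => (isClosed_discrete _).preimage (continuous_apply i)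

theorem exists_cy_subset {O : Set (ℕ → I)} (hO : IsOpen O) {x : ℕ → I} (hx : x ∈ O) :
    ∃ n, cy x n ⊆ O := by
  rw [isOpen_pi_iff] at hO
  obtain ⟨F, u, hu, hsub⟩ := hO x hx
  refine ⟨F.sup id + 1, fun y hy => hsub ?_⟩
  intro i hi
  have : y i = x i := hy i (Nat.lt_succ_of_le (Finset.le_sup (f := id) hi))
  rw [this]
  exact (hu i hi).2

theorem isOpen_iff_cy {O : Set (ℕ → I)} : IsOpen O ↔ ∀ x ∈ O, ∃ n, cy x n ⊆ O := by
  refine ⟨fun h x hx => exists_cy_subset h hx, fun h => ?_⟩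
  rw [isOpen_iff_mem_nhds]
  intro x hx
  obtain ⟨n, hn⟩ := h x hx
  exact mem_of_superset ((isOpen_cy x n).mem_nhds (self_mem_cy x n)) hn

theorem mem_closure_cy {S : Set (ℕ → I)} {x : ℕ → I} :
    x ∈ closure S ↔ ∀ n, ∃ y ∈ S, y ∈ cy x n := by
  constructor
  · intro h n
    obtain ⟨y, hy, hS⟩ := mem_closure_iff.1 h _ (isOpen_cy x n) (self_mem_cy x n)
    exact ⟨y, hS, hy⟩
  · intro h
    rw [mem_closure_iff]
    intro O hO hx
    obtain ⟨n, hn⟩ := exists_cy_subset hO hx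
    obtain ⟨y, hS, hy⟩ := h n
    exact ⟨y, hn hy, hS⟩

theorem isClosed_iff_cy {S : Set (ℕ → I)} :
    IsClosed S ↔ ∀ x, x ∉ S → ∃ n, ∀ y ∈ cy x n, y ∉ S := by
  rw [← isOpen_compl_iff, isOpen_iff_cy]
  rfl

/-- All cylinders meeting `T`. -/
def cyls (T : Set (ℕ → I)) : Set (Set (ℕ → I)) := {c | ∃ y ∈ T, ∃ n, c = cy y n}

/-- Fewer than `k` cylinders meet `T`. -/
def Thin (k : Cardinal.{u}) (T : Set (ℕ → I)) : Prop := Cardinal.mk (cyls T) < k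

theorem Thin.mono {k : Cardinal.{u}} {S T : Set (ℕ → I)} (h : Thin k T) (hs : S ⊆ T) :
    Thin k S := by
  refine lt_of_le_of_lt (Cardinal.mk_le_mk_of_subset ?_) h
  rintro c ⟨y, hy, n, rfl⟩
  exact ⟨y, hs hy, n, rfl⟩

/-- The embedded version of the class `σLW(<k) + 𝒢_δσ`. -/
def Sm (k : Cardinal.{u}) (S : Set (ℕ → I)) : Prop :=
  ∃ A G : ℕ → Set (ℕ → I), S = (⋃ n, A n) ∪ (⋃ n, G n) ∧
    (∀ n, ∀ x ∈ A n, ∃ m, Thin k (A n ∩ cy x m)) ∧ ∀ n, IsGδ (G n)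

variable {k : Cardinal.{u}}

theorem Sm.iUnion {S : ℕ → Set (ℕ → I)} (h : ∀ n, Sm k (S n)) : Sm k (⋃ n, S n) := by
  choose A G hS hA hG using h
  refine ⟨fun p => A p.unpair.1 p.unpair.2, fun p => G p.unpair.1 p.unpair.2, ?_,
    fun p => hA _ _, fun p => hG _ _⟩
  rw [Set.iUnion_unpair (f := A), Set.iUnion_unpair (f := G), ← iUnion_union_distrib]
  exact iUnion_congr hS

theorem Sm.of_isGδ {S : Set (ℕ → I)} (h : IsGδ S) : Sm k S :=
  ⟨fun _ => ∅, fun _ => S, by simp [iUnion_const], by simp, fun _ => h⟩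

theorem Sm.empty : Sm k (∅ : Set (ℕ → I)) := Sm.of_isGδ IsGδ.empty

theorem Sm.union {S T : Set (ℕ → I)} (h : Sm k S) (h' : Sm k T) : Sm k (S ∪ T) := by
  have : S ∪ T = ⋃ n : ℕ, if n = 0 then S else T := by
    ext x
    simp only [mem_union, mem_iUnion]
    constructor
    · rintro (hx | hx)
      · exact ⟨0, by simpa using hx⟩
      · exact ⟨1, by simpa using hx⟩
    · rintro ⟨n, hn⟩
      split_ifs at hn
      · exact Or.inl hn
      · exact Or.inr hn
  rw [this]
  refine Sm.iUnion fun n => ?_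
  split_ifs
  · exact h
  · exact h'

theorem Sm.of_thin {S : Set (ℕ → I)} (h : Thin k S) : Sm k S :=
  ⟨fun _ => S, fun _ => ∅, by simp [iUnion_const],
    fun _ _ _ => ⟨0, h.mono inter_subset_left⟩, fun _ => IsGδ.empty⟩

theorem isGδ_of_isClosed {E : Set (ℕ → I)} (h : IsClosed E) : IsGδ E := by
  let _ := TopologicalSpace.metrizableSpaceMetric (ℕ → I)
  exact h.isGδ

theorem Sm.inter_closed {S E : Set (ℕ → I)} (h : Sm k S) (hE : IsClosed E) : Sm k (S ∩ E) := by
  obtain ⟨A, G, rfl, hA, hG⟩ := h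
  refine ⟨fun n => A n ∩ E, fun n => G n ∩ E, ?_, ?_, ?_⟩
  · rw [union_inter_distrib_right, iUnion_inter, iUnion_inter]
  · rintro n x ⟨hx, -⟩
    obtain ⟨m, hm⟩ := hA n x hx
    exact ⟨m, hm.mono (inter_subset_inter_left _ inter_subset_left)⟩
  · exact fun n => (hG n).inter (isGδ_of_isClosed hE)

theorem not_Sm_mono {S T : Set (ℕ → I)} (h : ¬ Sm k S) {E : Set (ℕ → I)} (hE : IsClosed E)
    (hS : S = T ∩ E) : ¬ Sm k T := fun hT => h (hS ▸ hT.inter_closed hE)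

theorem not_Sm_cy_le {S : Set (ℕ → I)} {x : ℕ → I} {n m : ℕ} (h : ¬ Sm k (S ∩ cy x m))
    (hn : n ≤ m) : ¬ Sm k (S ∩ cy x n) :=
  not_Sm_mono h (isClosed_cy x m) (by
    rw [inter_assoc, inter_eq_right.2 (cy_anti x hn)])

theorem Sm.glue {S : Set (ℕ → I)} (l : ℕ) (h : ∀ x, Sm k (S ∩ cy x l)) : Sm k S := by
  have h' : ∀ c : Set (ℕ → I), ∃ A G : ℕ → Set (ℕ → I), (∃ x, c = cy x l) →
      S ∩ c = (⋃ n, A n) ∪ (⋃ n, G n) ∧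
      (∀ n, ∀ x ∈ A n, ∃ m, Thin k (A n ∩ cy x m)) ∧ ∀ n, IsGδ (G n) := by
    intro c
    by_cases hc : ∃ x, c = cy x l
    · obtain ⟨x, rfl⟩ := hc
      obtain ⟨A, G, h1⟩ := h x
      exact ⟨A, G, fun _ => h1⟩
    · exact ⟨fun _ => ∅, fun _ => ∅, fun h => absurd h hc⟩
  choose A G hAG using h'
  refine ⟨fun n => {x | x ∈ A (cy x l) n}, fun n => {x | x ∈ G (cy x l) n}, ?_, ?_, ?_⟩
  · ext x
    have := congrArg (x ∈ ·) (hAG (cy x l) ⟨x, rfl⟩).1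
    simp only [mem_inter_iff, self_mem_cy, and_true, mem_union, mem_iUnion] at this
    simp only [mem_union, mem_iUnion, mem_ofPred_eq]
    exact this.to_iff
  · intro n x hx
    obtain ⟨m, hm⟩ := (hAG (cy x l) ⟨x, rfl⟩).2.1 n x hx
    refine ⟨max m l, hm.mono ?_⟩
    rintro y ⟨hy, hy'⟩
    refine ⟨?_, cy_anti x (le_max_left _ _) hy'⟩
    rw [← cy_eq_of_le hy' (le_max_right _ _)]
    exact hy
  · intro n
    have h2 : ∀ c : Set (ℕ → I), ∃ O : ℕ → Set (ℕ → I), (∃ x, c = cy x l) →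
        (∀ m, IsOpen (O m)) ∧ G c n = ⋂ m, O m := by
      intro c
      by_cases hc : ∃ x, c = cy x l
      · obtain ⟨O, hO, hO'⟩ := ((hAG c hc).2.2 n).eq_iInter_nat
        exact ⟨O, fun _ => ⟨hO, hO'⟩⟩
      · exact ⟨fun _ => ∅, fun h => absurd h hc⟩
    choose O hO using h2
    have : {x | x ∈ G (cy x l) n} = ⋂ m, {x | x ∈ O (cy x l) m} := by
      ext x
      rw [mem_ofPred_eq, (hO (cy x l) ⟨x, rfl⟩).2]
      simp
    change IsGδ {x | x ∈ G (cy x l) n}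
    rw [this]
    refine IsGδ.iInter_of_isOpen fun m => ?_
    rw [isOpen_iff_cy]
    intro x hx
    obtain ⟨j, hj⟩ := exists_cy_subset ((hO (cy x l) ⟨x, rfl⟩).1 m) hx
    refine ⟨max j l, fun y hy => ?_⟩
    rw [mem_ofPred_eq, cy_eq_of_le hy (le_max_right _ _)]
    exact hj (cy_anti x (le_max_left _ _) hy)

end QKO

set_option linter.unusedSectionVars false

namespace QKO

variable {I : Type u} [TopologicalSpace I] [DiscreteTopology I] {k : Cardinal.{u}}

/-- `Y` is a nonempty relatively closed subset of `X` which is nowhere in the class `Sm`, and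
of first category, as witnessed by the sequence `C`. -/
structure Good (k : Cardinal.{u}) (X Y : Set (ℕ → I)) (C : ℕ → Set (ℕ → I)) : Prop where
  sub : Y ⊆ X
  ne : Y.Nonempty
  clo : ∀ x ∈ X, x ∈ closure Y → x ∈ Y
  big : ∀ x ∈ Y, ∀ n, ¬ Sm k (Y ∩ cy x n)
  ccl : ∀ m, IsClosed (C m)
  cmono : Monotone C
  cov : ∀ x ∈ Y, ∃ m, x ∈ C m
  nwd : ∀ m, ∀ x ∈ Y, ∀ n, ∃ y ∈ Y, y ∈ cy x n ∧ y ∉ C m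

/-- `T` can be covered by countably many closed sets with small traces on `Z`. -/
def Cov (k : Cardinal.{u}) (Z T : Set (ℕ → I)) : Prop :=
  ∃ H : ℕ → Set (ℕ → I), (∀ m, IsClosed (H m)) ∧ T ⊆ (⋃ m, H m) ∧ ∀ m, Sm k (Z ∩ H m)

theorem Cov.iUnion {Z : Set (ℕ → I)} {T : ℕ → Set (ℕ → I)} (h : ∀ n, Cov k Z (T n)) :
    Cov k Z (⋃ n, T n) := by
  choose H h1 h2 h3 using h
  refine ⟨fun p => H p.unpair.1 p.unpair.2, fun p => h1 _ _, ?_, fun p => h3 _ _⟩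
  rw [Set.iUnion_unpair (f := H)]
  exact iUnion_mono h2

theorem Cov.mono {Z S T : Set (ℕ → I)} (h : Cov k Z T) (hS : S ⊆ T) : Cov k Z S := by
  obtain ⟨H, h1, h2, h3⟩ := h
  exact ⟨H, h1, hS.trans h2, h3⟩

theorem Cov.union {Z S T : Set (ℕ → I)} (h : Cov k Z S) (h' : Cov k Z T) : Cov k Z (S ∪ T) := by
  refine (Cov.iUnion (T := fun n => if n = 0 then S else T) fun n => ?_).mono ?_
  · split_ifs
    · exact h
    · exact h'
  · rintro x (hx | hx)
    · exact mem_iUnion.2 ⟨0, by simpa using hx⟩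
    · exact mem_iUnion.2 ⟨1, by simpa using hx⟩

theorem Cov.glue {Z T : Set (ℕ → I)} (l : ℕ) :
    Cov k Z (T ∩ {x | Cov k Z (T ∩ cy x l)}) := by
  have h' : ∀ c : Set (ℕ → I), ∃ H : ℕ → Set (ℕ → I), Cov k Z (T ∩ c) →
      (∀ m, IsClosed (H m)) ∧ T ∩ c ⊆ (⋃ m, H m) ∧ ∀ m, Sm k (Z ∩ H m) := by
    intro c
    by_cases hc : Cov k Z (T ∩ c)
    · obtain ⟨H, h1⟩ := hc
      exact ⟨H, fun _ => h1⟩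
    · exact ⟨fun _ => ∅, fun h => absurd h hc⟩
  choose H hH using h'
  refine ⟨fun m => {x | Cov k Z (T ∩ cy x l) ∧ x ∈ H (cy x l) m}, ?_, ?_, ?_⟩
  · intro m
    rw [isClosed_iff_cy]
    intro x hx
    by_cases hc : Cov k Z (T ∩ cy x l)
    · have hx' : x ∉ H (cy x l) m := fun h => hx ⟨hc, h⟩
      obtain ⟨n, hn⟩ := isClosed_iff_cy.1 ((hH _ hc).1 m) x hx'
      refine ⟨max n l, ?_⟩
      rintro y hy ⟨-, hy2⟩
      rw [cy_eq_of_le hy (le_max_right _ _)] at hy2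
      exact hn y (cy_anti x (le_max_left _ _) hy) hy2
    · refine ⟨l, ?_⟩
      rintro y hy ⟨hy1, -⟩
      rw [cy_eq hy] at hy1
      exact hc hy1
  · rintro x ⟨hT, hx⟩
    obtain ⟨m, hm⟩ := mem_iUnion.1 ((hH _ hx).2.1 ⟨hT, self_mem_cy x l⟩)
    exact mem_iUnion.2 ⟨m, hx, hm⟩
  · intro m
    refine Sm.glue l fun x => ?_
    by_cases hc : Cov k Z (T ∩ cy x l)
    · have : Z ∩ {x | Cov k Z (T ∩ cy x l) ∧ x ∈ H (cy x l) m} ∩ cy x l =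
          Z ∩ H (cy x l) m ∩ cy x l := by
        ext y
        constructor
        · rintro ⟨⟨h1, -, h2⟩, h3⟩
          rw [cy_eq h3] at h2
          exact ⟨⟨h1, h2⟩, h3⟩
        · rintro ⟨⟨h1, h2⟩, h3⟩
          refine ⟨⟨h1, ?_⟩, h3⟩
          change Cov k Z (T ∩ cy y l) ∧ y ∈ H (cy y l) m
          rw [cy_eq h3]
          exact ⟨hc, h2⟩
      rw [this]
      exact ((hH _ hc).2.2 m).inter_closed (isClosed_cy x l)
    · have : Z ∩ {x | Cov k Z (T ∩ cy x l) ∧ x ∈ H (cy x l) m} ∩ cy x l = ∅ := by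
        rw [eq_empty_iff_forall_notMem]
        rintro y ⟨⟨h1, h4, h2⟩, h3⟩
        rw [cy_eq h3] at h4
        exact hc h4
      rw [this]
      exact Sm.empty

variable {X : Set (ℕ → I)} {F : ℕ → ℕ → Set (ℕ → I)}

/-- Inside every big closed set there is a good set. -/
theorem exists_good (hFc : ∀ i m, IsClosed (F i m)) (hFm : ∀ i, Monotone (F i))
    (hX : ∀ x, x ∈ X ↔ ∀ i, ∃ m, x ∈ F i m) {D : Set (ℕ → I)} (hD : IsClosed D)
    (hbig : ¬ Sm k (X ∩ D)) : ∃ Y C, Y ⊆ D ∧ Good k X Y C := by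
  set Z := X ∩ D with hZ
  set B : ℕ → Set (ℕ → I) := fun n => {x | x ∈ D ∧ ∀ m, x ∉ F n m} with hB
  have h1 : ∃ n, ¬ Cov k Z (B n) := by
    by_contra hcon
    push Not at hcon
    obtain ⟨H, hHc, hHs, hHZ⟩ := Cov.iUnion hcon
    apply hbig
    have : Z = (⋃ m, Z ∩ H m) ∪ (D ∩ ⋂ m, (H m)ᶜ) := by
      ext x
      constructor
      · intro hx
        by_cases hm : ∃ m, x ∈ H m
        · obtain ⟨m, hm⟩ := hm
          exact Or.inl (mem_iUnion.2 ⟨m, hx, hm⟩)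
        · push Not at hm
          exact Or.inr ⟨hx.2, mem_iInter.2 hm⟩
      · rintro (hx | ⟨hx, hx'⟩)
        · obtain ⟨m, hm, -⟩ := mem_iUnion.1 hx
          exact hm
        · refine ⟨(hX x).2 fun i => ?_, hx⟩
          by_contra hcon
          push Not at hcon
          obtain ⟨m, hm⟩ := mem_iUnion.1 (hHs (mem_iUnion.2 ⟨i, hx, hcon⟩))
          exact mem_iInter.1 hx' m hm
    rw [this]
    exact (Sm.iUnion hHZ).union (Sm.of_isGδ ((isGδ_of_isClosed hD).inter
      (IsGδ.iInter_of_isOpen fun m => (hHc m).isOpen_compl)))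
  obtain ⟨n, hn⟩ := h1
  set O : Set (ℕ → I) := ⋃ l, B n ∩ {x | Cov k Z (B n ∩ cy x l)} with hO
  have hOc : Cov k Z O := Cov.iUnion fun l => Cov.glue l
  set Q := B n \ O with hQ
  have hQB : ∀ x ∈ Q, ∀ l, ¬ Cov k Z (B n ∩ cy x l) := fun x hx l hc =>
    hx.2 (mem_iUnion.2 ⟨l, hx.1, hc⟩)
  have hQn : ∀ x ∈ Q, ∀ l, ¬ Cov k Z (Q ∩ cy x l) := by
    intro x hx l hc
    refine hQB x hx l ((hc.union hOc).mono ?_)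
    rintro y ⟨hy, hy'⟩
    by_cases hyO : y ∈ O
    · exact Or.inr hyO
    · exact Or.inl ⟨⟨hy, hyO⟩, hy'⟩
  have hQD : closure Q ⊆ D := closure_minimal (fun x hx => hx.1.1) hD
  have hbigQ : ∀ x ∈ Q, ∀ l, ¬ Sm k (X ∩ closure Q ∩ cy x l) := by
    intro x hx l hc
    apply hQn x hx l
    refine ⟨fun _ => closure (Q ∩ cy x l), fun _ => isClosed_closure, ?_, fun _ => ?_⟩
    · rw [iUnion_const]
      exact subset_closure
    · have := hc.inter_closed (E := closure (Q ∩ cy x l)) isClosed_closure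
      convert this using 1
      ext y
      constructor
      · rintro ⟨⟨h1, h2⟩, h3⟩
        refine ⟨⟨⟨h1, closure_mono inter_subset_left h3⟩, ?_⟩, h3⟩
        exact closure_minimal inter_subset_right (isClosed_cy x l) h3
      · rintro ⟨⟨⟨h1, h2⟩, h4⟩, h3⟩
        exact ⟨⟨h1, hQD h2⟩, h3⟩
  have hne : ∀ x ∈ Q, ∀ l, (X ∩ closure Q ∩ cy x l).Nonempty := by
    intro x hx l
    rw [nonempty_iff_ne_empty]
    intro h
    exact hbigQ x hx l (h ▸ Sm.empty)
  have hQne : Q.Nonempty := by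
    rw [nonempty_iff_ne_empty]
    intro h
    exact hn (hOc.mono (sdiff_eq_empty.1 h))
  refine ⟨X ∩ closure Q, F n, fun x hx => hQD hx.2, ?_⟩
  refine ⟨inter_subset_left, ?_, ?_, ?_, hFc n, hFm n, fun x hx => (hX x).1 hx.1 n, ?_⟩
  · obtain ⟨x, hx⟩ := hQne
    exact (hne x hx 0).mono inter_subset_left
  · intro x hx hx'
    exact ⟨hx, closure_minimal inter_subset_right isClosed_closure hx'⟩
  · rintro x ⟨hx, hx'⟩ l
    obtain ⟨y, hy, hy'⟩ := mem_closure_cy.1 hx' l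
    rw [← cy_eq hy']
    exact hbigQ y hy l
  · rintro m x ⟨hx, hx'⟩ l
    obtain ⟨y, hy, hy'⟩ := mem_closure_cy.1 hx' l
    obtain ⟨l', hl'⟩ := isClosed_iff_cy.1 (hFc n m) y (hy.1.2 m)
    obtain ⟨z, hz, hz'⟩ := hne y hy (max l l')
    refine ⟨z, hz, ?_, hl' z (cy_anti _ (le_max_right _ _) hz')⟩
    rw [← cy_eq hy']
    exact cy_anti _ (le_max_left _ _) hz'

theorem Good.inter_open {Y W : Set (ℕ → I)} {C : ℕ → Set (ℕ → I)} (h : Good k X Y C)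
    (hW : ∀ x ∈ W, ∃ n, ∀ y ∈ X, y ∈ cy x n → y ∈ W)
    (hW' : ∀ x ∈ X, x ∉ W → ∃ n, ∀ y ∈ X, y ∈ cy x n → y ∉ W)
    (hne : (Y ∩ W).Nonempty) : Good k X (Y ∩ W) C := by
  refine ⟨fun x hx => h.sub hx.1, hne, ?_, ?_, h.ccl, h.cmono, fun x hx => h.cov x hx.1, ?_⟩
  · intro x hx hx'
    refine ⟨h.clo x hx (closure_mono inter_subset_left hx'), ?_⟩
    by_contra hcon
    obtain ⟨n, hn⟩ := hW' x hx hcon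
    obtain ⟨y, hy, hy'⟩ := mem_closure_cy.1 hx' n
    exact hn y (h.sub hy.1) hy' hy.2
  · rintro x ⟨hx, hxW⟩ n
    obtain ⟨m, hm⟩ := hW x hxW
    refine not_Sm_cy_le (m := max n m) ?_ (le_max_left _ _)
    have : Y ∩ W ∩ cy x (max n m) = Y ∩ cy x (max n m) := by
      ext y
      constructor
      · rintro ⟨⟨h1, h2⟩, h3⟩
        exact ⟨h1, h3⟩
      · rintro ⟨h1, h3⟩
        exact ⟨⟨h1, hm y (h.sub h1) (cy_anti x (le_max_right _ _) h3)⟩, h3⟩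
    rw [this]
    exact h.big x hx _
  · rintro m x ⟨hx, hxW⟩ n
    obtain ⟨l, hl⟩ := hW x hxW
    obtain ⟨y, hy, hy1, hy2⟩ := h.nwd m x hx (max n l)
    exact ⟨y, ⟨hy, hl y (h.sub hy) (cy_anti x (le_max_right _ _) hy1)⟩,
      cy_anti x (le_max_left _ _) hy1, hy2⟩

/-- Enlarging a nowhere dense closed subset of a good set to a good nowhere dense set. -/
theorem exists_next (hFc : ∀ i m, IsClosed (F i m)) (hFm : ∀ i, Monotone (F i))
    (hX : ∀ x, x ∈ X ↔ ∀ i, ∃ m, x ∈ F i m) {Y : Set (ℕ → I)} {C : ℕ → Set (ℕ → I)}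
    (hY : Good k X Y C) (i j : ℕ) :
    ∃ Y' C', Good k X Y' C' ∧ Y' ⊆ Y ∧ Y ∩ C j ∩ F i j ⊆ Y' ∧
      (∀ x ∈ Y, ∀ n, ∃ y ∈ Y, y ∈ cy x n ∧ y ∉ Y') ∧
      ∀ z ∈ closure Y', ∃ m, z ∈ F i m := by
  classical
  set E := closure Y ∩ C j ∩ F i j with hE
  have hEc : IsClosed E := (isClosed_closure.inter (hY.ccl j)).inter (hFc i j)
  have hEX : ∀ x ∈ X, x ∈ E → x ∈ Y := fun x hx h => hY.clo x hx h.1.1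
  have hEx : ∀ z, z ∉ E → ∃ n, ∀ y ∈ cy z n, y ∉ E := fun z => isClosed_iff_cy.1 hEc z
  -- the maximal cylinder around `z` missing `E`
  set lam : (ℕ → I) → ℕ := fun z => if h : z ∉ E then Nat.find (hEx z h) else 0 with hlam
  have lam_spec : ∀ z, z ∉ E → ∀ y ∈ cy z (lam z), y ∉ E := by
    intro z hz
    simp only [hlam, hz, not_false_eq_true, dite_true]
    exact Nat.find_spec (hEx z hz)
  have lam_le : ∀ z, z ∉ E → ∀ n, (∀ y ∈ cy z n, y ∉ E) → lam z ≤ n := by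
    intro z hz n hn
    simp only [hlam, hz, not_false_eq_true, dite_true]
    exact Nat.find_min' (hEx z hz) hn
  have lam_eq : ∀ z, z ∉ E → ∀ y ∈ cy z (lam z), lam y = lam z := by
    intro z hz y hy
    have hyE := lam_spec z hz y hy
    apply le_antisymm
    · apply lam_le y hyE
      rw [cy_eq hy]
      exact lam_spec z hz
    · by_contra hlt
      push Not at hlt
      have : lam z ≤ lam y := by
        apply lam_le z hz
        rw [← cy_eq_of_le hy hlt.le]
        exact lam_spec y hyE
      omega
  have cyl_eq : ∀ z, z ∉ E → ∀ y ∈ cy z (lam z), cy y (lam y) = cy z (lam z) := by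
    intro z hz y hy
    rw [lam_eq z hz y hy, cy_eq hy]
  have hch : ∀ c : Set (ℕ → I), ∃ G D, (∃ z ∈ Y, z ∉ E ∧ c = cy z (lam z)) →
      Good k X G D ∧ G ⊆ Y ∧ G ⊆ c ∧ ∃ m, G ⊆ C m ∧ G ⊆ F i m := by
    intro c
    by_cases hc : ∃ z ∈ Y, z ∉ E ∧ c = cy z (lam z)
    · obtain ⟨z, hz, hzE, rfl⟩ := hc
      have h1 : ∃ m, ¬ Sm k (Y ∩ cy z (lam z) ∩ (C m ∩ F i m)) := by
        by_contra hcon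
        push Not at hcon
        refine hY.big z hz (lam z) ?_
        have := Sm.iUnion hcon
        convert this using 1
        ext y
        simp only [mem_iUnion]
        constructor
        · intro hy
          obtain ⟨m, hm⟩ := hY.cov y hy.1
          obtain ⟨m', hm'⟩ := (hX y).1 (hY.sub hy.1) i
          exact ⟨max m m', hy, hY.cmono (le_max_left _ _) hm, hFm i (le_max_right _ _) hm'⟩
        · rintro ⟨m, hy, -⟩
          exact hy
      obtain ⟨m, hm⟩ := h1
      have h2 : Y ∩ cy z (lam z) ∩ (C m ∩ F i m) =
          X ∩ (closure Y ∩ cy z (lam z) ∩ (C m ∩ F i m)) := by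
        ext y
        constructor
        · rintro ⟨⟨h1, h2⟩, h3⟩
          exact ⟨hY.sub h1, ⟨subset_closure h1, h2⟩, h3⟩
        · rintro ⟨h1, ⟨h2, h3⟩, h4⟩
          exact ⟨⟨hY.clo y h1 h2, h3⟩, h4⟩
      rw [h2] at hm
      obtain ⟨G, D, hGD, hG⟩ := exists_good hFc hFm hX
        ((isClosed_closure.inter (isClosed_cy _ _)).inter ((hY.ccl m).inter (hFc i m))) hm
      refine ⟨G, D, fun _ => ⟨hG, fun y hy => hY.clo y (hG.sub hy) (hGD hy).1.1,
        fun y hy => (hGD hy).1.2, m, fun y hy => (hGD hy).2.1, fun y hy => (hGD hy).2.2⟩⟩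
    · exact ⟨∅, fun _ => ∅, fun h => absurd h hc⟩
  choose G D hGD using hch
  set Y' : Set (ℕ → I) := {x | x ∈ Y ∧ (x ∈ E ∨ (x ∉ E ∧ x ∈ G (cy x (lam x))))} with hY'
  set C' : ℕ → Set (ℕ → I) := fun m => {x | x ∈ E ∨ (x ∉ E ∧ (∃ z ∈ Y, z ∈ cy x (lam x)) ∧
    x ∈ D (cy x (lam x)) m)} with hC'
  have hGz : ∀ z ∈ Y, z ∉ E → Good k X (G (cy z (lam z))) (D (cy z (lam z))) ∧
      G (cy z (lam z)) ⊆ Y ∧ G (cy z (lam z)) ⊆ cy z (lam z) ∧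
      ∃ m, G (cy z (lam z)) ⊆ C m ∧ G (cy z (lam z)) ⊆ F i m :=
    fun z hz hzE => hGD _ ⟨z, hz, hzE, rfl⟩
  have hGz' : ∀ x, x ∉ E → (∃ z ∈ Y, z ∈ cy x (lam x)) →
      Good k X (G (cy x (lam x))) (D (cy x (lam x))) ∧
      G (cy x (lam x)) ⊆ Y ∧ G (cy x (lam x)) ⊆ cy x (lam x) ∧
      ∃ m, G (cy x (lam x)) ⊆ C m ∧ G (cy x (lam x)) ⊆ F i m := by
    rintro x hx ⟨z, hz, hzx⟩
    have := hGz z hz (lam_spec x hx z hzx)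
    rwa [cyl_eq x hx z hzx] at this
  have memY' : ∀ x ∈ Y, x ∉ E → ∀ y ∈ cy x (lam x), y ∈ Y' ↔ y ∈ G (cy x (lam x)) := by
    intro x hx hxE y hy
    have hyE := lam_spec x hxE y hy
    constructor
    · rintro ⟨h1, h2 | ⟨-, h2⟩⟩
      · exact absurd h2 hyE
      · rwa [cyl_eq x hxE y hy] at h2
    · intro h
      refine ⟨(hGz x hx hxE).2.1 h, Or.inr ⟨hyE, ?_⟩⟩
      rwa [cyl_eq x hxE y hy]
  -- points of `Y'` outside `E` in every neighbourhood of a point of `Y ∩ E`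
  have esc : ∀ x ∈ Y, x ∈ E → ∀ n, ∃ y ∈ Y', y ∉ E ∧ y ∈ cy x n := by
    intro x hx hxE n
    obtain ⟨y, hy, hyx, hyC⟩ := hY.nwd j x hx n
    have hyE : y ∉ E := fun h => hyC h.1.2
    have hlt : n ≤ lam y := by
      by_contra hlt
      push Not at hlt
      have := lam_spec y hyE x (cy_anti y hlt.le (mem_cy_symm hyx))
      exact this hxE
    obtain ⟨g, hg⟩ := (hGz y hy hyE).1.ne
    have hgy := (hGz y hy hyE).2.2.1 hg
    refine ⟨g, (memY' y hy hyE g hgy).2 hg, lam_spec y hyE g hgy, ?_⟩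
    rw [← cy_eq hyx]
    exact cy_anti y hlt hgy
  have hY'Y : Y' ⊆ Y := fun x hx => hx.1
  have bigcase : ∀ x ∈ Y', x ∉ E → ∀ n, ¬ Sm k (Y' ∩ cy x n) := by
    intro x hx hxE n
    refine not_Sm_cy_le (m := max n (lam x)) ?_ (le_max_left _ _)
    have : Y' ∩ cy x (max n (lam x)) = G (cy x (lam x)) ∩ cy x (max n (lam x)) := by
      ext y
      constructor
      · rintro ⟨h1, h2⟩
        exact ⟨(memY' x hx.1 hxE y (cy_anti x (le_max_right _ _) h2)).1 h1, h2⟩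
      · rintro ⟨h1, h2⟩
        exact ⟨(memY' x hx.1 hxE y (cy_anti x (le_max_right _ _) h2)).2 h1, h2⟩
    rw [this]
    exact (hGz x hx.1 hxE).1.big x ((memY' x hx.1 hxE x (self_mem_cy _ _)).1 hx) _
  have nwdcase : ∀ m, ∀ x ∈ Y', x ∉ E → ∀ n, ∃ y ∈ Y', y ∈ cy x n ∧ y ∉ C' m := by
    intro m x hx hxE n
    have hxG := (memY' x hx.1 hxE x (self_mem_cy _ _)).1 hx
    obtain ⟨y, hy, hyx, hyD⟩ := (hGz x hx.1 hxE).1.nwd m x hxG (max n (lam x))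
    have hyl := cy_anti x (le_max_right _ _) hyx
    refine ⟨y, (memY' x hx.1 hxE y hyl).2 hy, cy_anti x (le_max_left _ _) hyx, ?_⟩
    rintro (h | ⟨-, -, h⟩)
    · exact lam_spec x hxE y hyl h
    · rw [cyl_eq x hxE y hyl] at h
      exact hyD h
  refine ⟨Y', C', ⟨fun x hx => hY.sub hx.1, ?_, ?_, ?_, ?_, ?_, ?_, ?_⟩, hY'Y, ?_, ?_, ?_⟩
  · obtain ⟨x, hx⟩ := hY.ne
    obtain ⟨y, hy, hyx, hyC⟩ := hY.nwd j x hx 0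
    have hyE : y ∉ E := fun h => hyC h.1.2
    obtain ⟨g, hg⟩ := (hGz y hy hyE).1.ne
    exact ⟨g, (memY' y hy hyE g ((hGz y hy hyE).2.2.1 hg)).2 hg⟩
  · intro x hx hxc
    have hxY : x ∈ Y := hY.clo x hx (closure_mono hY'Y hxc)
    by_cases hxE : x ∈ E
    · exact ⟨hxY, Or.inl hxE⟩
    · rw [memY' x hxY hxE x (self_mem_cy _ _)]
      apply (hGz x hxY hxE).1.clo x hx
      rw [mem_closure_cy]
      intro n
      obtain ⟨y, hy, hyx⟩ := mem_closure_cy.1 hxc (max n (lam x))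
      exact ⟨y, (memY' x hxY hxE y (cy_anti x (le_max_right _ _) hyx)).1 hy,
        cy_anti x (le_max_left _ _) hyx⟩
  · intro x hx n
    by_cases hxE : x ∈ E
    · obtain ⟨y, hy, hyE, hyx⟩ := esc x hx.1 hxE n
      rw [← cy_eq hyx]
      exact bigcase y hy hyE n
    · exact bigcase x hx hxE n
  · intro m
    rw [isClosed_iff_cy]
    intro x hx
    have hxE : x ∉ E := fun h => hx (Or.inl h)
    by_cases hz : ∃ z ∈ Y, z ∈ cy x (lam x)
    · have hxD : x ∉ D (cy x (lam x)) m := fun h => hx (Or.inr ⟨hxE, hz, h⟩)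
      obtain ⟨n, hn⟩ := isClosed_iff_cy.1 ((hGz' x hxE hz).1.ccl m) x hxD
      refine ⟨max n (lam x), fun y hy => ?_⟩
      have hyl := cy_anti x (le_max_right _ _) hy
      rintro (h | ⟨-, -, h⟩)
      · exact lam_spec x hxE y hyl h
      · rw [cyl_eq x hxE y hyl] at h
        exact hn y (cy_anti x (le_max_left _ _) hy) h
    · refine ⟨lam x, fun y hy => ?_⟩
      rintro (h | ⟨-, h, -⟩)
      · exact lam_spec x hxE y hy h
      · rw [cyl_eq x hxE y hy] at h
        exact hz h
  · intro m m' hmm x hx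
    rcases hx with h | ⟨h1, h2, h3⟩
    · exact Or.inl h
    · exact Or.inr ⟨h1, h2, (hGz' x h1 h2).1.cmono hmm h3⟩
  · intro x hx
    by_cases hxE : x ∈ E
    · exact ⟨0, Or.inl hxE⟩
    · obtain ⟨m, hm⟩ := (hGz x hx.1 hxE).1.cov x ((memY' x hx.1 hxE x (self_mem_cy _ _)).1 hx)
      exact ⟨m, Or.inr ⟨hxE, ⟨x, hx.1, self_mem_cy _ _⟩, hm⟩⟩
  · intro m x hx n
    by_cases hxE : x ∈ E
    · obtain ⟨y, hy, hyE, hyx⟩ := esc x hx.1 hxE n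
      rw [← cy_eq hyx]
      exact nwdcase m y hy hyE n
    · exact nwdcase m x hx hxE n
  · rintro x ⟨⟨h1, h2⟩, h3⟩
    exact ⟨h1, Or.inl ⟨⟨subset_closure h1, h2⟩, h3⟩⟩
  · intro x hx n
    obtain ⟨y, hy, hyx, hyC⟩ := hY.nwd j x hx n
    have hyE : y ∉ E := fun h => hyC h.1.2
    obtain ⟨m, hm, -⟩ := (hGz y hy hyE).2.2.2
    obtain ⟨z, hz, hzy, hzC⟩ := hY.nwd m y hy (max n (lam y))
    refine ⟨z, hz, ?_, fun h => hzC (hm ?_)⟩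
    · rw [← cy_eq hyx]
      exact cy_anti y (le_max_left _ _) hzy
    · exact (memY' y hy hyE z (cy_anti y (le_max_right _ _) hzy)).1 h
  · intro z hz
    by_cases hzE : z ∈ E
    · exact ⟨j, hzE.2⟩
    · obtain ⟨y, hy, hyz⟩ := mem_closure_cy.1 hz (lam z)
      obtain ⟨-, -, -, m, -, hm⟩ := hGz' z hzE ⟨y, hy.1, hyz⟩
      refine ⟨m, ?_⟩
      rw [← (hFc i m).closure_eq, mem_closure_cy]
      intro n
      obtain ⟨w, hw, hwz⟩ := mem_closure_cy.1 hz (max n (lam z))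
      have hwl := cy_anti z (le_max_right _ _) hwz
      refine ⟨w, ?_, cy_anti z (le_max_left _ _) hwz⟩
      apply hm
      have hwE := lam_spec z hzE w hwl
      have := (memY' w hw.1 hwE w (self_mem_cy _ _)).1 hw
      rwa [cyl_eq z hzE w hwl] at this

end QKO

set_option linter.unusedSectionVars false

namespace QKO

variable {I : Type u} [TopologicalSpace I] [DiscreteTopology I] {k : Cardinal.{u}}

theorem mk_image_le_of_ker {α β γ : Type u} {S : Set α} {f : α → β} {g : α → γ}
    (h : ∀ x ∈ S, ∀ y ∈ S, g x = g y → f x = f y) :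
    Cardinal.mk (f '' S) ≤ Cardinal.mk (g '' S) := by
  have h1 : ∀ c : f '' S, ∃ x ∈ S, f x = c := fun c => c.2
  choose r hr hr' using h1
  refine Cardinal.mk_le_of_injective (f := fun c => (⟨g (r c), r c, hr c, rfl⟩ : g '' S)) ?_
  intro c d hcd
  have := h _ (hr c) _ (hr d) (congrArg Subtype.val hcd)
  rw [hr', hr'] at this
  exact Subtype.ext this

theorem mk_cyls_le {S : Set (ℕ → I)} {c : Cardinal.{u}} (hc : Cardinal.aleph0 ≤ c)
    (h : ∀ m, Cardinal.mk ((fun y => cy y m) '' S) ≤ c) : Cardinal.mk (cyls S) ≤ c := by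
  have : cyls S = ⋃ m : ℕ, (fun y => cy y m) '' S := by
    ext d
    simp only [cyls, mem_ofPred_eq, mem_iUnion, mem_image]
    constructor
    · rintro ⟨y, hy, n, rfl⟩
      exact ⟨n, y, hy, rfl⟩
    · rintro ⟨n, y, hy, rfl⟩
      exact ⟨y, hy, n, rfl⟩
  rw [this]
  have h2 := Cardinal.mk_iUnion_le_lift (fun m : ℕ => (fun y => cy y m) '' S)
  simp only [Cardinal.mk_nat, Cardinal.lift_aleph0] at h2
  rw [Cardinal.lift_uzero] at h2
  refine h2.trans ?_
  refine (mul_le_mul' hc (ciSup_le' fun m => ?_)).trans (Cardinal.mul_eq_self hc).le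
  simpa using h m

variable {X : Set (ℕ → I)}

theorem exists_split (hk : Cardinal.aleph0 ≤ k) {Y : Set (ℕ → I)} {C : ℕ → Set (ℕ → I)}
    (hY : Good k X Y C) {x0 : ℕ → I} (hx0 : x0 ∈ Y) (n j : ℕ) :
    ∃ p : (ℕ → I) → Set (ℕ → I),
      (∀ x ∈ X, ∃ m, ∀ y ∈ X, y ∈ cy x m → p y = p x) ∧
      (∀ x y, p y = p x → y ∈ cy x j) ∧ k ≤ Cardinal.mk (p '' (Y ∩ cy x0 n)) := by
  classical
  set S := Y ∩ cy x0 n with hS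
  have hSX : S ⊆ X := fun x hx => hY.sub hx.1
  have hmono : ∀ (T : Set (ℕ → I)) (a b : ℕ), a ≤ b →
      Cardinal.mk ((fun y => cy y a) '' T) ≤ Cardinal.mk ((fun y => cy y b) '' T) := by
    intro T a b hab
    refine mk_image_le_of_ker ?_
    intro x _ y _ hxy
    exact cy_eq_of_le (mem_cy_of_eq hxy) hab
  -- general facts about maps of the form `y ↦ cy y (r y)`
  have hgen : ∀ r : (ℕ → I) → ℕ, (∀ y, j ≤ r y) →
      ∀ x y, cy y (r y) = cy x (r x) → y ∈ cy x j := by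
    intro r hr x y hxy
    have h1 : y ∈ cy x (r x) := hxy ▸ self_mem_cy y (r y)
    exact cy_anti x (hr x) h1
  by_cases h1 : ∃ m, k ≤ Cardinal.mk ((fun y => cy y m) '' S)
  · obtain ⟨m, hm⟩ := h1
    refine ⟨fun y => cy y (max m j), ?_, hgen (fun _ => max m j) fun _ => le_max_right _ _,
      hm.trans (hmono S _ _ (le_max_left _ _))⟩
    intro x _
    exact ⟨max m j, fun y _ hy => cy_eq hy⟩
  push Not at h1
  have hnS : ¬ IsClosed S := fun h => hY.big x0 hx0 n (Sm.of_isGδ (isGδ_of_isClosed h))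
  obtain ⟨z, hz, hzS⟩ : ∃ z, z ∈ closure S ∧ z ∉ S := by
    by_contra hcon
    push Not at hcon
    exact hnS (isClosed_of_closure_subset hcon)
  have hzX : z ∉ X := by
    intro hzX
    refine hzS ⟨hY.clo z hzX (closure_mono inter_subset_left hz), ?_⟩
    have := closure_mono (inter_subset_right (s := Y) (t := cy x0 n)) hz
    rwa [(isClosed_cy x0 n).closure_eq] at this
  set mu : (ℕ → I) → ℕ := fun y => if h : ∃ i, y i ≠ z i then Nat.find h else 0 with hmu
  have hmu1 : ∀ y ∈ X, y (mu y) ≠ z (mu y) ∧ ∀ i < mu y, y i = z i := by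
    intro y hy
    have hne : ∃ i, y i ≠ z i := by
      by_contra hcon
      push Not at hcon
      exact hzX (funext hcon ▸ hy)
    simp only [hmu, dif_pos hne]
    refine ⟨Nat.find_spec hne, fun i hi => ?_⟩
    exact not_not.1 (Nat.find_min hne hi)
  have hmu2 : ∀ x ∈ X, ∀ y ∈ X, y ∈ cy x (mu x + 1) → mu y = mu x := by
    intro x hx y hy hxy
    obtain ⟨a1, a2⟩ := hmu1 x hx
    obtain ⟨b1, b2⟩ := hmu1 y hy
    apply le_antisymm
    · by_contra hcon
      push Not at hcon
      exact a1 (by rw [← hxy _ (Nat.lt_succ_self _), b2 _ hcon])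
    · by_contra hcon
      push Not at hcon
      exact b1 (by rw [hxy _ (by omega), a2 _ hcon])
  have hunb : ∀ m, ∃ y ∈ S, m ≤ mu y := by
    intro m
    obtain ⟨y, hy, hy'⟩ := mem_closure_cy.1 hz m
    refine ⟨y, hy, ?_⟩
    by_contra hcon
    push Not at hcon
    exact (hmu1 y (hSX hy)).1 (hy' _ hcon)
  have hl : ∀ m, ∃ l, Cardinal.aleph0 < k → (∃ y ∈ S, mu y = m) →
      Cardinal.mk ((fun y => cy y m) '' S) ≤
        Cardinal.mk ((fun y => cy y l) '' {y | y ∈ S ∧ mu y = m}) := by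
    intro m
    by_contra hcon
    push Not at hcon
    obtain ⟨hk', ⟨y, hy, hym⟩, -⟩ := hcon 0
    have hthin : Thin k {y | y ∈ S ∧ mu y = m} := by
      refine lt_of_le_of_lt (mk_cyls_le (le_max_left Cardinal.aleph0 _) fun l =>
        ((hcon l).2.2.le).trans (le_max_right _ _)) (max_lt hk' (h1 m))
    refine hY.big y hy.1 (max n (m + 1)) (Sm.of_thin (hthin.mono ?_))
    rintro w ⟨hw, hw'⟩
    refine ⟨⟨hw, ?_⟩, ?_⟩
    · rw [← cy_eq hy.2]
      exact cy_anti y (le_max_left _ _) hw'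
    · rw [← hym]
      refine hmu2 y (hSX hy) w (hY.sub hw) (cy_anti y ?_ hw')
      rw [hym]
      exact le_max_right _ _
  choose l hl using hl
  set r : (ℕ → I) → ℕ := fun y => max (max j (mu y + 1)) (l (mu y)) with hr
  have hker : ∀ x ∈ X, ∀ y ∈ X, cy x (r x) = cy y (r y) → mu x = mu y := by
    intro x hx y hy hxy
    refine hmu2 y hy x hx ?_
    have : x ∈ cy y (r y) := hxy ▸ self_mem_cy x (r x)
    exact cy_anti y ((le_max_right _ _).trans (le_max_left _ _)) this
  refine ⟨fun y => cy y (r y), ?_,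
    hgen r fun y => (le_max_left _ _).trans (le_max_left _ _), ?_⟩
  · intro x hx
    refine ⟨r x, fun y hy hxy => ?_⟩
    have : mu y = mu x := hmu2 x hx y hy
      (cy_anti x ((le_max_right _ _).trans (le_max_left _ _)) hxy)
    have hre : r y = r x := by simp only [hr, this]
    simp only [hre]
    exact cy_eq hxy
  by_contra hcon
  push Not at hcon
  have hinf : Cardinal.aleph0 ≤ Cardinal.mk ((fun y => cy y (r y)) '' S) := by
    have h2 : Cardinal.mk ((fun y => ULift.up.{u} (mu y)) '' S) ≤
        Cardinal.mk ((fun y => cy y (r y)) '' S) := by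
      refine mk_image_le_of_ker ?_
      intro x hx y hy hxy
      rw [hker x (hSX hx) y (hSX hy) hxy]
    refine le_trans ?_ h2
    rw [Cardinal.aleph0_le_mk_iff, Set.infinite_coe_iff]
    intro hfin
    have hfin2 : (mu '' S).Finite := by
      have := hfin.image ULift.down
      rw [image_image] at this
      exact this
    obtain ⟨b, hb⟩ := hfin2.bddAbove
    obtain ⟨y, hy, hby⟩ := hunb (b + 1)
    have := hb ⟨y, hy, rfl⟩
    omega
  have hk' : Cardinal.aleph0 < k := lt_of_le_of_lt hinf hcon
  refine hY.big x0 hx0 n (Sm.of_thin (lt_of_le_of_lt (mk_cyls_le hinf fun m => ?_) hcon))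
  obtain ⟨y, hy, hym⟩ := hunb m
  refine (hmono S _ _ hym).trans ((hl (mu y) hk' ⟨y, hy, rfl⟩).trans ?_)
  refine le_trans (mk_image_le_of_ker (g := fun y => cy y (r y)) ?_)
    (Cardinal.mk_le_mk_of_subset (image_mono fun w hw => hw.1))
  rintro a ⟨ha, ha'⟩ b ⟨hb, hb'⟩ hab
  have h3 : a ∈ cy b (r b) := by
    have : a ∈ cy a (r a) := self_mem_cy a (r a)
    exact hab ▸ this
  refine cy_eq_of_le h3 ?_
  rw [← hb']
  exact le_max_right _ _

end QKO

set_option linter.unusedSectionVars false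

namespace QKO

variable {I : Type u} [TopologicalSpace I] [DiscreteTopology I] {k : Cardinal.{u}}

/-- The base point of `QBase k`. -/
def bp (k : Cardinal.{u}) : QBase k := Sum.inr PUnit.unit

/-- A point of `QBase k` other than the base point. -/
def ql {k : Cardinal.{u}} (b : DiscT k) : QBase k := Sum.inl b

theorem ql_ne (b : DiscT k) : ql b ≠ bp k := fun h => Sum.inl_ne_inr h

theorem ql_inj {b c : DiscT k} (h : ql b = ql c) : b = c := Sum.inl_injective h

open Classical in
/-- The length of the initial segment of base points. -/
noncomputable def tau (j : ℕ) (a : Fin (j + 1) → QBase k) : ℕ :=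
  Nat.findGreatest (fun i => ∀ l : Fin (j + 1), l.1 < i → a l = bp k) j

theorem tau_le (j : ℕ) (a : Fin (j + 1) → QBase k) : tau j a ≤ j := by
  classical
  unfold tau
  exact Nat.findGreatest_le _

theorem le_tau {j : ℕ} {a : Fin (j + 1) → QBase k} {i : ℕ} (hi : i ≤ j)
    (h : ∀ l : Fin (j + 1), l.1 < i → a l = bp k) : i ≤ tau j a := by
  classical
  unfold tau
  exact Nat.le_findGreatest hi h

theorem tau_spec {j : ℕ} {a : Fin (j + 1) → QBase k} (l : Fin (j + 1)) (h : l.1 < tau j a) :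
    a l = bp k := by
  classical
  unfold tau at h
  exact Nat.findGreatest_spec (P := fun i => ∀ l : Fin (j + 1), l.1 < i → a l = bp k)
    (Nat.zero_le j) (fun l hl => absurd hl (Nat.not_lt_zero _)) l h

theorem mk_QBase (hk : Cardinal.aleph0 ≤ k) : Cardinal.mk (QBase k) = k := by
  have : Cardinal.mk (QBase k) = Cardinal.mk (DiscT k) + 1 := by
    unfold QBase
    simp
  rw [this]
  have h2 : Cardinal.mk (DiscT k) = k := Cardinal.mk_out k
  rw [h2]
  exact Cardinal.add_one_eq hk

theorem mk_tau_fiber (hk : Cardinal.aleph0 ≤ k) {i j : ℕ} (hi : i ≤ j) :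
    Cardinal.mk {a : Fin (j + 1) → QBase k | tau j a = i} = k := by
  classical
  apply le_antisymm
  · refine (Cardinal.mk_set_le _).trans ?_
    have : Cardinal.mk (Fin (j + 1) → QBase k) = k ^ ((j + 1 : ℕ) : Cardinal.{u}) := by
      rw [Cardinal.mk_arrow, mk_QBase hk, Cardinal.mk_fin]
      simp
    rw [this]
    exact Cardinal.power_nat_le hk
  · have hD : Cardinal.mk (DiscT k) = k := Cardinal.mk_out k
    nth_rewrite 1 [← hD]
    refine Cardinal.mk_le_of_injective (f := fun b : DiscT k =>
      (⟨fun l => if l.1 = i then ql b else bp k, ?_⟩ :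
        {a : Fin (j + 1) → QBase k | tau j a = i})) ?_
    · rw [mem_ofPred_eq]
      apply le_antisymm
      · by_contra hcon
        push Not at hcon
        have := tau_spec ⟨i, Nat.lt_succ_of_le hi⟩ hcon
        simp only [if_true] at this
        exact ql_ne b this
      · refine le_tau hi ?_
        intro l hl
        exact if_neg (by omega)
    · intro b c hbc
      have := congrFun (congrArg Subtype.val hbc) ⟨i, Nat.lt_succ_of_le hi⟩
      simp only [if_true] at this
      exact ql_inj this

theorem exists_bijOn {α β : Type u} {S : Set α} {T : Set β} [Nonempty β]
    (h : Cardinal.mk S = Cardinal.mk T) : ∃ f : α → β, BijOn f S T := by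
  classical
  obtain ⟨e⟩ := Cardinal.eq.1 h
  refine ⟨fun x => if hx : x ∈ S then e ⟨x, hx⟩ else Classical.arbitrary β, ?_, ?_, ?_⟩
  · intro x hx
    simp only [dif_pos hx]
    exact (e ⟨x, hx⟩).2
  · intro x hx y hy hxy
    simp only [dif_pos hx, dif_pos hy] at hxy
    exact congrArg Subtype.val (e.injective (Subtype.ext hxy))
  · intro y hy
    refine ⟨e.symm ⟨y, hy⟩, (e.symm ⟨y, hy⟩).2, ?_⟩
    simp

variable {X : Set (ℕ → I)}

/-- Locally constant on `X`. -/
def LC (X : Set (ℕ → I)) {β : Type*} (p : (ℕ → I) → β) : Prop :=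
  ∀ x ∈ X, ∃ m, ∀ y ∈ X, y ∈ cy x m → p y = p x

/-- Locally constant functions on `X` have at most `k` values. -/
def Ext (k : Cardinal.{u}) (X : Set (ℕ → I)) : Prop :=
  ∀ (β : Type u) (p : (ℕ → I) → β), LC X p → Cardinal.mk (p '' X) ≤ k

theorem exists_stage (hk : Cardinal.aleph0 ≤ k) (hext : Ext k X) {L : ℕ → Set (ℕ → I)}
    {C : ℕ → ℕ → Set (ℕ → I)} (hgood : ∀ i, Good k X (L i) (C i))
    (hsub : ∀ i, L (i + 1) ⊆ L i) (hnwd : ∀ i, ∃ x ∈ L i, x ∉ L (i + 1)) (j : ℕ) :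
    ∃ q : (ℕ → I) → (Fin (j + 1) → QBase k), LC (L 0) q ∧
      (∀ a, ∃ x ∈ L (tau j a), q x = a) ∧
      (∀ i ≤ j, ∀ x ∈ L i, i ≤ tau j (q x)) ∧
      (∀ x ∈ L 0, ∀ y ∈ L 0, q x = q y → y ∈ cy x j) := by
  classical
  have hanti : Antitone L := antitone_nat_of_succ_le hsub
  choose xi hxi hxi' using hnwd
  have hm : ∀ i, ∃ m, ∀ y ∈ cy (xi i) m, y ∉ L (i + 1) := by
    intro i
    by_contra hcon
    push Not at hcon
    refine hxi' i ((hgood (i + 1)).clo _ ((hgood i).sub (hxi i)) (mem_closure_cy.2 fun n => ?_))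
    obtain ⟨y, hy, hy'⟩ := hcon n
    exact ⟨y, hy', hy⟩
  choose mm hmm using hm
  have hp := fun i => exists_split hk (hgood i) (hxi i) (mm i) j
  choose pp hpp1 hpp2 hpp3 using hp
  set p : (ℕ → I) → Set (ℕ → I) × (Fin (j + 1) → Option (Set (ℕ → I))) := fun x =>
    (cy x j, fun i => if x ∈ cy (xi i) (mm i) then some (pp i x) else none) with hpdef
  have hpLC : LC X p := by
    intro x hx
    have h1 : ∀ᶠ m in atTop, ∀ i : Fin (j + 1), (mm i ≤ m ∧
        ∀ y ∈ X, y ∈ cy x m → pp i y = pp i x) := by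
      rw [eventually_all]
      intro i
      obtain ⟨m, hm⟩ := hpp1 i x hx
      filter_upwards [eventually_ge_atTop m, eventually_ge_atTop (mm i)] with m' h1 h2
      exact ⟨h2, fun y hy hy' => hm y hy (cy_anti x h1 hy')⟩
    obtain ⟨m, hm, hjm⟩ := (h1.and (eventually_ge_atTop j)).exists
    refine ⟨m, fun y hy hxy => ?_⟩
    refine Prod.ext (cy_eq_of_le hxy hjm) (funext fun i => ?_)
    obtain ⟨h2, h3⟩ := hm i
    have h4 : y ∈ cy (xi i) (mm i) ↔ x ∈ cy (xi i) (mm i) := by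
      have := cy_eq_of_le hxy h2
      constructor
      · intro h
        rw [← cy_eq h, this]
        exact self_mem_cy _ _
      · intro h
        rw [← cy_eq h, ← this]
        exact self_mem_cy _ _
    simp only [hpdef, h4, h3 y hy hxy]
  set T : Set (ℕ → I) × (Fin (j + 1) → Option (Set (ℕ → I))) → ℕ := fun c =>
    Nat.findGreatest (fun i => ∃ x ∈ L i, p x = c) j with hT
  have hTle : ∀ c, T c ≤ j := fun c => Nat.findGreatest_le _
  have hT1 : ∀ i ≤ j, ∀ x ∈ L i, i ≤ T (p x) := fun i hi x hx =>
    Nat.le_findGreatest (P := fun i => ∃ y ∈ L i, p y = p x) hi ⟨x, hx, rfl⟩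
  have hT2 : ∀ c ∈ p '' L 0, ∃ x ∈ L (T c), p x = c := fun c hc =>
    Nat.findGreatest_spec (P := fun i => ∃ x ∈ L i, p x = c) (Nat.zero_le j) hc
  have hD : ∀ i ≤ j, Cardinal.mk {c | c ∈ p '' L 0 ∧ T c = i} = k := by
    intro i hi
    apply le_antisymm
    · refine le_trans (Cardinal.mk_le_mk_of_subset ?_) (hext _ p hpLC)
      rintro c ⟨hc, -⟩
      exact image_mono (hgood 0).sub hc
    · refine (hpp3 i).trans (le_trans (mk_image_le_of_ker (g := p) ?_)
        (Cardinal.mk_le_mk_of_subset ?_))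
      · rintro x ⟨-, hx⟩ y ⟨-, hy⟩ hxy
        have := congrFun (congrArg Prod.snd hxy) ⟨i, Nat.lt_succ_of_le hi⟩
        simp only [hpdef, hx, hy, if_true, Option.some.injEq] at this
        exact this
      · rintro c ⟨x, ⟨hx, hx'⟩, rfl⟩
        refine ⟨⟨x, hanti (Nat.zero_le i) hx, rfl⟩, ?_⟩
        refine le_antisymm ?_ (hT1 i hi x hx)
        by_contra hcon
        push Not at hcon
        obtain ⟨y, hy, hxy⟩ := hT2 (p x) ⟨x, hanti (Nat.zero_le i) hx, rfl⟩
        have := congrFun (congrArg Prod.snd hxy) ⟨i, Nat.lt_succ_of_le hi⟩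
        simp only [hpdef, hx', if_true] at this
        have hy' : y ∈ cy (xi i) (mm i) := by
          by_contra h
          rw [if_neg h] at this
          exact absurd this (by simp)
        exact hmm i y hy' (hanti (Nat.succ_le_of_lt hcon) hy)
  have : Nonempty (Fin (j + 1) → QBase k) := ⟨fun _ => bp k⟩
  have he : ∀ i, ∃ e : Set (ℕ → I) × (Fin (j + 1) → Option (Set (ℕ → I))) →
      (Fin (j + 1) → QBase k), i ≤ j → BijOn e {c | c ∈ p '' L 0 ∧ T c = i}
        {a : Fin (j + 1) → QBase k | tau j a = i} := by
    intro i
    by_cases hi : i ≤ j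
    · obtain ⟨e, he⟩ := exists_bijOn ((hD i hi).trans (mk_tau_fiber hk hi).symm)
      exact ⟨e, fun _ => he⟩
    · exact ⟨fun _ _ => bp k, fun h => absurd h hi⟩
  choose e he using he
  have htau : ∀ x ∈ L 0, tau j (e (T (p x)) (p x)) = T (p x) := by
    intro x hx
    exact (he _ (hTle _)).mapsTo ⟨⟨x, hx, rfl⟩, rfl⟩
  refine ⟨fun x => e (T (p x)) (p x), ?_, ?_, ?_, ?_⟩
  · intro x hx
    obtain ⟨m, hm⟩ := hpLC x ((hgood 0).sub hx)
    exact ⟨m, fun y hy hxy => by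
      simp only [hm y ((hgood 0).sub hy) hxy]⟩
  · intro a
    obtain ⟨c, ⟨hc, hc'⟩, hca⟩ := (he _ (tau_le j a)).surjOn
      (show a ∈ {b | tau j b = tau j a} from rfl)
    obtain ⟨x, hx, rfl⟩ := hT2 c hc
    rw [hc'] at hx
    refine ⟨x, hx, ?_⟩
    simp only [hc', hca]
  · intro i hi x hx
    rw [htau x (hanti (Nat.zero_le i) hx)]
    exact hT1 i hi x hx
  · intro x hx y hy hxy
    have h1 : T (p x) = T (p y) := by rw [← htau x hx, ← htau y hy]; exact congrArg _ hxy
    simp only [h1] at hxy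
    have h2 := (he _ (hTle _)).injOn ⟨⟨x, hx, rfl⟩, h1⟩ ⟨⟨y, hy, rfl⟩, rfl⟩ hxy
    exact mem_cy_of_eq (congrArg Prod.fst h2).symm

end QKO

set_option linter.unusedSectionVars false

namespace QKO

variable {I : Type u} [TopologicalSpace I] [DiscreteTopology I] {k : Cardinal.{u}}
variable {X : Set (ℕ → I)} {F : ℕ → ℕ → Set (ℕ → I)}

/-- A decreasing sequence of good sets, each one nowhere dense in the previous one. -/
structure Flag (k : Cardinal.{u}) (X : Set (ℕ → I)) (F : ℕ → ℕ → Set (ℕ → I)) where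
  L : ℕ → Set (ℕ → I)
  C : ℕ → ℕ → Set (ℕ → I)
  good : ∀ i, Good k X (L i) (C i)
  sub : ∀ i, L (i + 1) ⊆ L i
  nwd : ∀ i, ∀ x ∈ L i, ∀ n, ∃ y ∈ L i, y ∈ cy x n ∧ y ∉ L (i + 1)
  clo : ∀ i, ∀ z ∈ closure (L (i + 1)), ∃ m, z ∈ F i m
  op : ∀ x ∈ L 0, ∃ n, ∀ y ∈ X, y ∈ cy x n → y ∈ L 0

theorem exists_tail (hFc : ∀ i m, IsClosed (F i m)) (hFm : ∀ i, Monotone (F i))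
    (hX : ∀ x, x ∈ X ↔ ∀ i, ∃ m, x ∈ F i m) {Y : Set (ℕ → I)} {C : ℕ → Set (ℕ → I)}
    (hY : Good k X Y C) (t j : ℕ) :
    ∃ (E : ℕ → Set (ℕ → I)) (D : ℕ → ℕ → Set (ℕ → I)), E 0 = Y ∧ D 0 = C ∧
      (∀ n, Good k X (E n) (D n)) ∧ (∀ n, E (n + 1) ⊆ E n) ∧
      (∀ i, ∀ x ∈ E i, ∀ n, ∃ y ∈ E i, y ∈ cy x n ∧ y ∉ E (i + 1)) ∧
      (∀ i, ∀ z ∈ closure (E (i + 1)), ∃ m, z ∈ F (t + i) m) ∧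
      Y ∩ C j ∩ F t j ⊆ E 1 := by
  have h := fun (P : {P : Set (ℕ → I) × (ℕ → Set (ℕ → I)) // Good k X P.1 P.2}) (i : ℕ) =>
    exists_next hFc hFm hX P.2 i j
  choose f g h1 h2 h3 h4 h5 using h
  let E : ℕ → {P : Set (ℕ → I) × (ℕ → Set (ℕ → I)) // Good k X P.1 P.2} := fun n =>
    Nat.rec ⟨(Y, C), hY⟩ (fun n P => ⟨(f P (t + n), g P (t + n)), h1 P (t + n)⟩) n
  exact ⟨fun n => (E n).1.1, fun n => (E n).1.2, rfl, rfl, fun n => (E n).2,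
    fun n => h2 (E n) (t + n), fun n => h4 (E n) (t + n), fun n => h5 (E n) (t + n),
    h3 (E 0) t⟩

theorem exists_init (hFc : ∀ i m, IsClosed (F i m)) (hFm : ∀ i, Monotone (F i))
    (hX : ∀ x, x ∈ X ↔ ∀ i, ∃ m, x ∈ F i m) {C : ℕ → Set (ℕ → I)}
    (hY : Good k X X C) : ∃ s : Flag k X F, s.L 0 = X := by
  obtain ⟨E, D, e1, e2, e3, e4, e5, e6, -⟩ := exists_tail hFc hFm hX hY 0 0
  refine ⟨⟨E, D, e3, e4, e5, fun i z hz => ?_, ?_⟩, e1⟩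
  · simpa using e6 i z hz
  · intro x _
    exact ⟨0, fun y hy _ => e1 ▸ hy⟩

theorem exists_nextFlag (hFc : ∀ i m, IsClosed (F i m)) (hFm : ∀ i, Monotone (F i))
    (hX : ∀ x, x ∈ X ↔ ∀ i, ∃ m, x ∈ F i m) (s : Flag k X F) (j t : ℕ) {W : Set (ℕ → I)}
    (hW : ∀ x ∈ W, ∃ n, ∀ y ∈ X, y ∈ cy x n → y ∈ W)
    (hW' : ∀ x ∈ X, x ∉ W → ∃ n, ∀ y ∈ X, y ∈ cy x n → y ∉ W)
    (hne : (s.L t ∩ W).Nonempty) :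
    ∃ s' : Flag k X F, (∀ l ≤ t, s'.L l = s.L l ∩ W ∧ s'.C l = s.C l) ∧
      s.L t ∩ W ∩ s.C t j ∩ F t j ⊆ s'.L (t + 1) := by
  have hanti : Antitone s.L := antitone_nat_of_succ_le s.sub
  have hg : ∀ l ≤ t, Good k X (s.L l ∩ W) (s.C l) := fun l hl =>
    (s.good l).inter_open hW hW' (hne.mono (inter_subset_inter_left _ (hanti hl)))
  obtain ⟨E, D, e1, e2, e3, e4, e5, e6, e7⟩ := exists_tail hFc hFm hX (hg t le_rfl) t j
  set L' : ℕ → Set (ℕ → I) := fun l => if l < t then s.L l ∩ W else E (l - t) with hL'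
  set C' : ℕ → ℕ → Set (ℕ → I) := fun l => if l < t then s.C l else D (l - t) with hC'
  have hL1 : ∀ l ≤ t, L' l = s.L l ∩ W := by
    intro l hl
    by_cases h : l < t
    · simp only [hL', if_pos h]
    · obtain rfl : l = t := by omega
      simp only [hL', lt_irrefl, if_false, Nat.sub_self, e1]
  have hL2 : ∀ n, L' (t + n) = E n := by
    intro n
    simp only [hL']
    rw [if_neg (by omega), Nat.add_sub_cancel_left]
  have hC1 : ∀ l ≤ t, C' l = s.C l := by
    intro l hl
    by_cases h : l < t
    · simp only [hC', if_pos h]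
    · obtain rfl : l = t := by omega
      simp only [hC', lt_irrefl, if_false, Nat.sub_self, e2]
  have hC2 : ∀ n, C' (t + n) = D n := by
    intro n
    simp only [hC']
    rw [if_neg (by omega), Nat.add_sub_cancel_left]
  have hcases : ∀ l, l < t ∨ ∃ n, l = t + n := by
    intro l
    by_cases h : l < t
    · exact Or.inl h
    · exact Or.inr ⟨l - t, by omega⟩
  refine ⟨⟨L', C', ?_, ?_, ?_, ?_, ?_⟩, fun l hl => ⟨hL1 l hl, hC1 l hl⟩, ?_⟩
  · intro l
    rcases hcases l with h | ⟨n, rfl⟩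
    · rw [hL1 l h.le, hC1 l h.le]
      exact hg l h.le
    · rw [hL2, hC2]
      exact e3 n
  · intro l
    rcases hcases l with h | ⟨n, rfl⟩
    · rw [hL1 l h.le, hL1 (l + 1) h]
      exact inter_subset_inter_left _ (s.sub l)
    · rw [add_assoc, hL2, hL2]
      exact e4 n
  · intro l
    rcases hcases l with h | ⟨n, rfl⟩
    · rw [hL1 l h.le, hL1 (l + 1) h]
      rintro x ⟨hx, hxW⟩ n
      obtain ⟨m, hm⟩ := hW x hxW
      obtain ⟨y, hy, hy', hyn⟩ := s.nwd l x hx (max n m)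
      exact ⟨y, ⟨hy, hm y ((s.good l).sub hy) (cy_anti x (le_max_right _ _) hy')⟩,
        cy_anti x (le_max_left _ _) hy', fun h => hyn h.1⟩
    · rw [add_assoc, hL2, hL2]
      exact e5 n
  · intro l
    rcases hcases l with h | ⟨n, rfl⟩
    · rw [hL1 (l + 1) h]
      intro z hz
      exact s.clo l z (closure_mono inter_subset_left hz)
    · rw [add_assoc, hL2]
      exact e6 n
  · rw [hL1 0 (Nat.zero_le t)]
    rintro x ⟨hx, hxW⟩
    obtain ⟨m, hm⟩ := hW x hxW
    obtain ⟨n, hn⟩ := s.op x hx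
    exact ⟨max m n, fun y hy hxy => ⟨hn y hy (cy_anti x (le_max_right _ _) hxy),
      hm y hy (cy_anti x (le_max_left _ _) hxy)⟩⟩
  · change _ ⊆ L' (t + 1)
    rw [hL2]
    exact e7

/-- The result of one step of the construction. -/
theorem exists_step (hk : Cardinal.aleph0 ≤ k) (hext : Ext k X)
    (hFc : ∀ i m, IsClosed (F i m)) (hFm : ∀ i, Monotone (F i))
    (hX : ∀ x, x ∈ X ↔ ∀ i, ∃ m, x ∈ F i m) (s : Flag k X F) (j : ℕ) :
    ∃ (q : (ℕ → I) → (Fin (j + 1) → QBase k)) (nx : (Fin (j + 1) → QBase k) → Flag k X F),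
      (∀ i ≤ j, ∀ x ∈ s.L i, i ≤ tau j (q x)) ∧
      (∀ x ∈ s.L 0, ∀ y ∈ s.L 0, q x = q y → y ∈ cy x j) ∧
      (∀ a, ∀ l ≤ tau j a, (∀ x, x ∈ (nx a).L l ↔ x ∈ s.L l ∧ q x = a) ∧
        (nx a).C l = s.C l) ∧
      (∀ a, ∀ x ∈ s.L (tau j a), q x = a → x ∈ s.C (tau j a) j → x ∈ F (tau j a) j →
        x ∈ (nx a).L (tau j a + 1)) := by
  have hanti : Antitone s.L := antitone_nat_of_succ_le s.sub
  obtain ⟨q, q1, q2, q3, q4⟩ := exists_stage hk hext s.good s.sub (fun i => by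
    obtain ⟨x, hx⟩ := (s.good i).ne
    obtain ⟨y, hy, -, hy'⟩ := s.nwd i x hx 0
    exact ⟨y, hy, hy'⟩) j
  have h : ∀ a, ∃ s' : Flag k X F, (∀ l ≤ tau j a,
      s'.L l = s.L l ∩ {x | x ∈ s.L 0 ∧ q x = a} ∧ s'.C l = s.C l) ∧
      s.L (tau j a) ∩ {x | x ∈ s.L 0 ∧ q x = a} ∩ s.C (tau j a) j ∩ F (tau j a) j ⊆
        s'.L (tau j a + 1) := by
    intro a
    refine exists_nextFlag hFc hFm hX s j (tau j a) ?_ ?_ ?_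
    · rintro x ⟨hx, hxa⟩
      obtain ⟨m, hm⟩ := s.op x hx
      obtain ⟨n, hn⟩ := q1 x hx
      refine ⟨max m n, fun y hy hxy => ?_⟩
      have hy0 := hm y hy (cy_anti x (le_max_left _ _) hxy)
      exact ⟨hy0, (hn y hy0 (cy_anti x (le_max_right _ _) hxy)).trans hxa⟩
    · intro x hx hxW
      by_cases hx0 : x ∈ s.L 0
      · obtain ⟨n, hn⟩ := q1 x hx0
        refine ⟨n, fun y hy hxy hyW => hxW ⟨hx0, ?_⟩⟩
        rw [← hn y hyW.1 hxy]
        exact hyW.2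
      · have : x ∉ closure (s.L 0) := fun h => hx0 ((s.good 0).clo x hx h)
        rw [mem_closure_cy] at this
        push Not at this
        obtain ⟨n, hn⟩ := this
        exact ⟨n, fun y hy hxy hyW => hn y hyW.1 hxy⟩
    · obtain ⟨x, hx, hxa⟩ := q2 a
      exact ⟨x, hx, hanti (Nat.zero_le _) hx, hxa⟩
  choose nx hnx hnx' using h
  refine ⟨q, nx, q3, q4, ?_, ?_⟩
  · intro a l hl
    refine ⟨fun x => ?_, (hnx a l hl).2⟩
    rw [(hnx a l hl).1]
    exact ⟨fun h => ⟨h.1, h.2.2⟩, fun h => ⟨h.1, hanti (Nat.zero_le _) h.1, h.2⟩⟩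
  · intro a x hx hxa h1 h2
    exact hnx' a ⟨⟨⟨hx, hanti (Nat.zero_le _) hx, hxa⟩, h1⟩, h2⟩

end QKO

set_option linter.unusedSectionVars false

namespace QKO

variable {I : Type u} [TopologicalSpace I] [DiscreteTopology I] {k : Cardinal.{u}}
variable {X : Set (ℕ → I)} {F : ℕ → ℕ → Set (ℕ → I)}

theorem main_embedded (hk : Cardinal.aleph0 ≤ k) (hext : Ext k X)
    (hFc : ∀ i m, IsClosed (F i m)) (hFm : ∀ i, Monotone (F i))
    (hX : ∀ x, x ∈ X ↔ ∀ i, ∃ m, x ∈ F i m) {C0 : ℕ → Set (ℕ → I)} (hC0 : Good k X X C0) :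
    ∃ Y : (ℕ → I) → ℕ → ℕ → QBase k,
      (∀ x ∈ X, ∀ i, ∃ N, ∀ n ≥ N, Y x i n = bp k) ∧
      (∀ y : ℕ → ℕ → QBase k, (∀ i, ∃ N, ∀ n ≥ N, y i n = bp k) → ∃ x ∈ X, Y x = y) ∧
      (∀ x ∈ X, ∀ i n, ∃ m, ∀ x' ∈ X, x' ∈ cy x m → Y x' i n = Y x i n) ∧
      (∀ x ∈ X, ∀ j, ∀ x' ∈ X, (∀ i n, i + n ≤ j → Y x' i n = Y x i n) → x' ∈ cy x j) := by
  classical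
  obtain ⟨s0, hs0⟩ := exists_init hFc hFm hX hC0
  choose q nx h1 h2 h3 h4 using fun (s : Flag k X F) (j : ℕ) =>
    exists_step hk hext hFc hFm hX s j
  let A : (ℕ → ℕ → QBase k) → (j : ℕ) → (Fin (j + 1) → QBase k) := fun y j i => y i (j - i)
  let S : (ℕ → ℕ → QBase k) → ℕ → Flag k X F := fun y j =>
    Nat.rec s0 (fun j s => nx s j (A y j)) j
  have S0 : ∀ y, S y 0 = s0 := fun y => rfl
  have Ss : ∀ y j, S y (j + 1) = nx (S y j) j (A y j) := fun y j => rfl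
  let st : (ℕ → I) → ℕ → Flag k X F := fun x j =>
    Nat.rec s0 (fun j s => nx s j (q s j x)) j
  have st0 : ∀ x, st x 0 = s0 := fun x => rfl
  have sts : ∀ x j, st x (j + 1) = nx (st x j) j (q (st x j) j x) := fun x j => rfl
  let qd : Flag k X F → ℕ → (ℕ → I) → ℕ → QBase k := fun s j x i =>
    if h : i < j + 1 then q s j x ⟨i, h⟩ else bp k
  let Y : (ℕ → I) → ℕ → ℕ → QBase k := fun x i n => qd (st x (i + n)) (i + n) x i
  have hAY : ∀ x j, A (Y x) j = q (st x j) j x := by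
    intro x j
    funext i
    have hij : (i : ℕ) + (j - i) = j := by have := i.2; omega
    change qd (st x (i + (j - i))) (i + (j - i)) x i = _
    rw [hij]
    simp only [qd, dif_pos i.2]
  have hSst : ∀ x j, S (Y x) j = st x j := by
    intro x j
    induction j with
    | zero => rfl
    | succ j ih => rw [Ss, sts, hAY, ih]
  -- membership in the zeroth level
  have hL0 : ∀ y j x, x ∈ (S y (j + 1)).L 0 ↔ x ∈ (S y j).L 0 ∧ q (S y j) j x = A y j := by
    intro y j x
    rw [Ss]
    exact (h3 (S y j) j (A y j) 0 (Nat.zero_le _)).1 x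
  have hanti0 : ∀ y, Antitone fun j => (S y j).L 0 := fun y =>
    antitone_nat_of_succ_le fun j x hx => ((hL0 y j x).1 hx).1
  have hB : ∀ y j x, x ∈ (S y j).L 0 → st x j = S y j := by
    intro y j x
    induction j with
    | zero => intro _; rfl
    | succ j ih =>
      intro hx
      obtain ⟨h5, h6⟩ := (hL0 y j x).1 hx
      rw [sts, Ss, ih h5, h6]
  have hB2 : ∀ y j x, x ∈ (S y (j + 1)).L 0 → ∀ i n, i + n = j → Y x i n = y i n := by
    intro y j x hx i n hin
    obtain ⟨h5, h6⟩ := (hL0 y j x).1 hx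
    subst hin
    change qd (st x (i + n)) (i + n) x i = _
    have hlt : i < i + n + 1 := by omega
    rw [hB y _ x h5]
    simp only [qd, dif_pos hlt, h6]
    change y i (i + n - i) = _
    rw [Nat.add_sub_cancel_left]
  have hCc : ∀ y j x x', x ∈ (S y (j + 1)).L 0 → x' ∈ (S y (j + 1)).L 0 → x' ∈ cy x j := by
    intro y j x x' hx hx'
    obtain ⟨h5, h6⟩ := (hL0 y j x).1 hx
    obtain ⟨h7, h8⟩ := (hL0 y j x').1 hx'
    exact h2 _ j x h5 x' h7 (h6.trans h8.symm)
  have hself : ∀ x ∈ X, ∀ j, x ∈ (S (Y x) j).L 0 := by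
    intro x hx j
    induction j with
    | zero => rw [S0, hs0]; exact hx
    | succ j ih =>
      rw [hL0]
      exact ⟨ih, by rw [hSst, hAY]⟩
  -- closure lemma
  have hmonoL : ∀ y i J, (∀ j ≥ J, i ≤ tau j (A y j)) → ∀ j ≥ J,
      (S y j).L i ⊆ (S y J).L i ∧ (S y j).C i = (S y J).C i := by
    intro y i J hJ j hj
    induction j, hj using Nat.le_induction with
    | base => exact ⟨subset_rfl, rfl⟩
    | succ j hj ih =>
      rw [Ss]
      obtain ⟨h5, h6⟩ := h3 (S y j) j (A y j) i (hJ j hj)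
      exact ⟨fun x hx => ih.1 ((h5 x).1 hx).1, h6.trans ih.2⟩
  have hantiL : ∀ y j, Antitone (S y j).L := fun y j => antitone_nat_of_succ_le (S y j).sub
  have hD : ∀ y i J z, (∀ j ≥ J, i ≤ tau j (A y j)) →
      (∀ j, ∀ x ∈ (S y (j + 1)).L 0, z ∈ cy x j) → z ∈ closure ((S y J).L i) := by
    intro y i J z hJ hz
    rw [mem_closure_cy]
    intro n
    obtain ⟨x, hx⟩ := ((S y (max n J + 1)).good i).ne
    refine ⟨x, (hmonoL y i J hJ (max n J + 1) (by omega)).1 hx, ?_⟩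
    exact cy_anti z (le_max_left n J) (mem_cy_symm (hz _ x (hantiL y (max n J + 1) (Nat.zero_le i) hx)))
  refine ⟨Y, ?_, ?_, ?_, ?_⟩
  · intro x hx
    have hin : ∀ i, ∃ J, ∀ j ≥ J, x ∈ (S (Y x) j).L i := by
      intro i
      induction i with
      | zero => exact ⟨0, fun j _ => hself x hx j⟩
      | succ i ih =>
        obtain ⟨J0, hJ0⟩ := ih
        set J := max J0 (i + 1) with hJ
        have hJi : ∀ j ≥ J, x ∈ (S (Y x) j).L i := fun j hj => hJ0 j (by omega)
        have hqA : ∀ j, q (S (Y x) j) j x = A (Y x) j := by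
          intro j
          rw [hSst, hAY]
        have htau : ∀ j ≥ J, i ≤ tau j (A (Y x) j) := by
          intro j hj
          rw [← hqA]
          exact h1 _ j i (by omega) x (hJi j hj)
        by_cases hex : ∃ j ≥ J, x ∈ (S (Y x) j).L (i + 1)
        · obtain ⟨j0, hj0, hxj⟩ := hex
          refine ⟨j0, fun j hj => ?_⟩
          induction j, hj using Nat.le_induction with
          | base => exact hxj
          | succ j hj ih =>
            rw [Ss]
            have : i + 1 ≤ tau j (A (Y x) j) := by
              rw [← hqA]
              exact h1 _ j (i + 1) (by omega) x ih
            rw [(h3 (S (Y x) j) j (A (Y x) j) (i + 1) this).1 x]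
            exact ⟨ih, hqA j⟩
        · exfalso
          apply hex
          obtain ⟨m, hm⟩ := ((S (Y x) J).good i).cov x (hJi J le_rfl)
          obtain ⟨m', hm'⟩ := (hX x).1 hx i
          set J' := max J (max m m') with hJ'
          by_cases hall : ∀ j ≥ J', i + 1 ≤ tau j (A (Y x) j)
          · refine ⟨J', le_max_left _ _, ?_⟩
            refine ((S (Y x) J').good (i + 1)).clo x hx ?_
            refine hD (Y x) (i + 1) J' x hall ?_
            intro j w hw
            exact hCc _ j w x hw (hself x hx (j + 1))
          · push Not at hall
            obtain ⟨j, hj, hjt⟩ := hall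
            have hjJ : j ≥ J := (le_max_left _ _).trans hj
            have hti : tau j (A (Y x) j) = i := by
              have := htau j hjJ
              omega
            refine ⟨j + 1, by omega, ?_⟩
            have h5 := h4 (S (Y x) j) j (A (Y x) j) x
            rw [hti] at h5
            rw [Ss]
            refine h5 (hJi j hjJ) (hqA j) ?_ (hFm i (by omega : m' ≤ j) hm')
            rw [(hmonoL (Y x) i J htau j hjJ).2]
            exact ((S (Y x) J).good i).cmono (by omega : m ≤ j) hm
    intro i
    obtain ⟨J, hJ⟩ := hin (i + 1)
    refine ⟨max J (i + 1), fun n hn => ?_⟩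
    have h5 := h1 (S (Y x) (i + n)) (i + n) (i + 1) (by omega) x (hJ (i + n) (by omega))
    have hlt : i < i + n + 1 := by omega
    have h6 := tau_spec (a := q (S (Y x) (i + n)) (i + n) x) ⟨i, hlt⟩ h5
    change qd (st x (i + n)) (i + n) x i = _
    simp only [qd, dif_pos hlt]
    rw [hSst] at h6
    exact h6
  · intro y hy
    have htau : ∀ i, ∃ J, ∀ j ≥ J, i ≤ tau j (A y j) := by
      intro i
      choose N hN using hy
      refine ⟨i + (Finset.range i).sup N, fun j hj => le_tau (by omega) fun l hl => ?_⟩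
      refine hN l _ ?_
      have : N l ≤ (Finset.range i).sup N := Finset.le_sup (Finset.mem_range.2 hl)
      omega
    choose w hw using fun j => ((S y j).good 0).ne
    let z : ℕ → I := fun i => w (i + 2) i
    have hz : ∀ j, ∀ x ∈ (S y (j + 1)).L 0, z ∈ cy x j := by
      intro j x hx i hi
      change w (i + 2) i = x i
      refine ((hCc y (i + 1) x (w (i + 2)) (hanti0 y (by omega : i + 1 + 1 ≤ j + 1) hx)
        (hw (i + 2))) i (by omega))
    have hzX : z ∈ X := by
      rw [hX]
      intro i
      obtain ⟨J, hJ⟩ := htau (i + 1)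
      exact (S y J).clo i z (hD y (i + 1) J z hJ hz)
    refine ⟨z, hzX, ?_⟩
    have hzL : ∀ j, z ∈ (S y j).L 0 := fun j =>
      ((S y j).good 0).clo z hzX (hD y 0 j z (fun _ _ => Nat.zero_le _) hz)
    funext i n
    exact hB2 y (i + n) z (hzL (i + n + 1)) i n rfl
  · intro x hx i n
    obtain ⟨m, hm⟩ := (S (Y x) (i + n + 1)).op x (hself x hx (i + n + 1))
    exact ⟨m, fun x' hx' hxx => hB2 (Y x) (i + n) x' (hm x' hx' hxx) i n rfl⟩
  · intro x hx j x' hx' hxx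
    have h5 : ∀ l ≤ j + 1, S (Y x') l = S (Y x) l := by
      intro l
      induction l with
      | zero => intro _; rfl
      | succ l ih =>
        intro hl
        rw [Ss, Ss, ih (by omega)]
        have : A (Y x') l = A (Y x) l := by
          funext i
          refine hxx i (l - i) ?_
          have := i.2
          omega
        rw [this]
    refine hCc (Y x) j x x' (hself x hx (j + 1)) ?_
    rw [← h5 _ le_rfl]
    exact hself x' hx' (j + 1)

theorem homeo_embedded (hk : Cardinal.aleph0 ≤ k) (hext : Ext k X)
    (hFc : ∀ i m, IsClosed (F i m)) (hFm : ∀ i, Monotone (F i))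
    (hX : ∀ x, x ∈ X ↔ ∀ i, ∃ m, x ∈ F i m) {C0 : ℕ → Set (ℕ → I)} (hC0 : Good k X X C0) :
    Nonempty (↥X ≃ₜ QkOmega k) := by
  obtain ⟨Y, y1, y2, y3, y4⟩ := main_embedded hk hext hFc hFm hX hC0
  let e : ↥X → (ℕ → {x : ℕ → QBase k // ∀ᶠ n in Filter.atTop, x n = Sum.inr PUnit.unit}) :=
    fun x i => ⟨Y x i, eventually_atTop.2 (y1 x x.2 i)⟩
  have hbij : Function.Bijective e := by
    constructor
    · intro x x' hxx
      apply Subtype.ext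
      funext l
      have h : ∀ i n, Y x i n = Y x' i n := fun i n =>
        congrFun (congrArg Subtype.val (congrFun hxx i)) n
      exact y4 x' x'.2 (l + 1) x x.2 (fun i n _ => h i n) l (Nat.lt_succ_self l)
    · intro y
      obtain ⟨x, hx, hxy⟩ := y2 (fun i => (y i).1) (fun i => eventually_atTop.1 (y i).2)
      refine ⟨⟨x, hx⟩, ?_⟩
      funext i
      exact Subtype.ext (congrFun hxy i)
  have hcont : Continuous e := by
    refine continuous_pi fun i => Continuous.subtype_mk (continuous_pi fun n => ?_) _
    refine IsLocallyConstant.continuous ?_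
    rw [IsLocallyConstant.iff_exists_open]
    intro x
    obtain ⟨m, hm⟩ := y3 x x.2 i n
    exact ⟨Subtype.val ⁻¹' cy x m, (isOpen_cy _ _).preimage continuous_subtype_val,
      self_mem_cy _ _, fun x' hx' => hm x' x'.2 hx'⟩
  let E := Equiv.ofBijective e hbij
  have hinv : Continuous E.symm := by
    rw [continuous_iff_continuousAt]
    intro y
    rw [ContinuousAt, tendsto_def]
    intro O hO
    rw [mem_nhds_subtype] at hO
    obtain ⟨O', hO', hOO⟩ := hO
    obtain ⟨V, hV, hVo, hyV⟩ := mem_nhds_iff.1 hO'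
    obtain ⟨j, hj⟩ := exists_cy_subset hVo hyV
    have hco : ∀ i n, Continuous fun y' : (ℕ → {x : ℕ → QBase k //
        ∀ᶠ n in Filter.atTop, x n = Sum.inr PUnit.unit}) => (y' i).1 n := fun i n =>
      (continuous_apply n).comp (continuous_subtype_val.comp (continuous_apply i))
    have : ∀ᶠ y' in 𝓝 y, ∀ i ∈ Finset.range (j + 1), ∀ n ∈ Finset.range (j + 1),
        (y' i).1 n = (y i).1 n := by
      rw [Filter.eventually_all_finset]
      intro i _
      rw [Filter.eventually_all_finset]
      intro n _
      exact (hco i n).continuousAt.eventually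
        ((isOpen_discrete {(y i).1 n}).mem_nhds rfl)
    filter_upwards [this] with y' hy'
    refine hOO (hV (hj ?_))
    refine y4 (E.symm y) (E.symm y).2 j (E.symm y') (E.symm y').2 ?_
    intro i n hin
    have h5 : ∀ w, Y (E.symm w) i n = (w i).1 n := fun w =>
      congrFun (congrArg Subtype.val (congrFun (E.apply_symm_apply w) i)) n
    rw [h5, h5]
    exact hy' i (Finset.mem_range.2 (by omega)) n (Finset.mem_range.2 (by omega))
  exact ⟨{ toEquiv := E, continuous_toFun := hcont, continuous_invFun := hinv }⟩

end QKO

set_option linter.unusedSectionVars false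

namespace QKO

variable {I : Type u} [TopologicalSpace I] [DiscreteTopology I] {k : Cardinal.{u}}

/-- A form of Lavrentiev's theorem. -/
theorem isGδ_range_of_embedding {B : Type u} [TopologicalSpace B] {g : B → ℕ → I}
    (hg : IsEmbedding g) (hG : IsGδ (range g)) {Y : Type u} [TopologicalSpace Y]
    [TopologicalSpace.MetrizableSpace Y] {φ : B → Y} (hφ : IsEmbedding φ) :
    IsGδ (range φ) := by
  let _ : MetricSpace Y := TopologicalSpace.metrizableSpaceMetric Y
  obtain ⟨O, hO, hO'⟩ := hG.eq_iInter_nat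
  set P : ℕ → Set Y → B → ℕ → Prop := fun n V b l => IsOpen V ∧ n ≤ l ∧
    (∀ b', φ b' ∈ V → g b' ∈ cy (g b) l) ∧ cy (g b) l ⊆ O n with hP
  set W : ℕ → Set Y := fun n => ⋃₀ {V | ∃ b l, P n V b l} with hW
  have hWo : ∀ n, IsOpen (W n) := by
    intro n
    refine isOpen_sUnion ?_
    rintro V ⟨b, l, h⟩
    exact h.1
  have heq : range φ = closure (range φ) ∩ ⋂ n, W n := by
    apply Subset.antisymm
    · rintro _ ⟨b, rfl⟩
      refine ⟨subset_closure ⟨b, rfl⟩, mem_iInter.2 fun n => ?_⟩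
      have hb : g b ∈ O n := by
        have : g b ∈ ⋂ n, O n := hO' ▸ mem_range_self b
        exact mem_iInter.1 this n
      obtain ⟨l0, hl0⟩ := exists_cy_subset (hO n) hb
      have ho : IsOpen (g ⁻¹' cy (g b) (max l0 n)) := (isOpen_cy _ _).preimage hg.continuous
      obtain ⟨V, hV, hVe⟩ := hφ.isInducing.isOpen_iff.1 ho
      refine ⟨V, ⟨b, max l0 n, hV, le_max_right _ _, ?_, ?_⟩, ?_⟩
      · intro b' hb'
        have : b' ∈ φ ⁻¹' V := hb'
        rw [hVe] at this
        exact this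
      · exact (cy_anti _ (le_max_left _ _)).trans hl0
      · have : b ∈ φ ⁻¹' V := by
          rw [hVe]
          exact self_mem_cy _ _
        exact this
    · rintro z ⟨hz, hzW⟩
      have h1 : ∀ n, ∃ V b l, P n V b l ∧ z ∈ V := by
        intro n
        obtain ⟨V, ⟨b, l, h⟩, hzV⟩ := mem_iInter.1 hzW n
        exact ⟨V, b, l, h, hzV⟩
      choose V b l hV hzV using h1
      have h2 : ∀ n : ℕ, ∃ c, (∀ m ≤ n, φ c ∈ V m) ∧ dist (φ c) z < 1 / ((n : ℝ) + 1) := by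
        intro n
        have ho : IsOpen ((⋂ m ∈ Finset.range (n + 1), V m) ∩
            Metric.ball z (1 / ((n : ℝ) + 1))) :=
          (isOpen_biInter_finset fun m _ => (hV m).1).inter Metric.isOpen_ball
        obtain ⟨_, ⟨h3, h4⟩, ⟨c, rfl⟩⟩ := mem_closure_iff.1 hz _ ho
          ⟨mem_iInter₂.2 fun m _ => hzV m, Metric.mem_ball_self (by positivity)⟩
        exact ⟨c, fun m hm => mem_iInter₂.1 h3 m (Finset.mem_range.2 (by omega)), h4⟩
      choose c hc hcz using h2
      have h3 : ∀ n m, n ≤ m → g (c m) ∈ cy (g (b n)) (l n) := fun n m hnm =>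
        (hV n).2.2.1 _ (hc m n hnm)
      set w : ℕ → I := fun i => g (c (i + 1)) i with hw
      have h4 : ∀ n, w ∈ cy (g (b n)) (l n) := by
        intro n i hi
        have hl : i + 1 ≤ l (i + 1) := (hV (i + 1)).2.1
        have e1 := h3 (i + 1) (i + 1) le_rfl i (by omega)
        have e2 := h3 (i + 1) (max (i + 1) n) (le_max_left _ _) i (by omega)
        have e3 := h3 n (max (i + 1) n) (le_max_right _ _) i hi
        change g (c (i + 1)) i = _
        rw [e1, ← e2, e3]
      have h5 : w ∈ range g := by
        rw [hO']
        exact mem_iInter.2 fun n => (hV n).2.2.2 (h4 n)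
      obtain ⟨b0, hb0⟩ := h5
      have h6 : Tendsto (fun n => g (c n)) atTop (𝓝 (g b0)) := by
        rw [tendsto_pi_nhds]
        intro i
        refine tendsto_const_nhds.congr' ?_
        filter_upwards [eventually_ge_atTop (i + 1)] with n hn
        have hl : n ≤ l n := (hV n).2.1
        have e1 := h3 n n le_rfl i (by omega)
        have e2 := h4 n i (by omega)
        rw [hb0, e1, e2]
      have h7 : Tendsto c atTop (𝓝 b0) := hg.tendsto_nhds_iff.2 h6
      have h8 : Tendsto (fun n => φ (c n)) atTop (𝓝 (φ b0)) :=
        (hφ.continuous.tendsto b0).comp h7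
      have h9 : Tendsto (fun n => φ (c n)) atTop (𝓝 z) := by
        rw [tendsto_iff_dist_tendsto_zero]
        refine squeeze_zero (fun _ => dist_nonneg) (fun n => (hcz n).le)
          tendsto_one_div_add_atTop_nhds_zero_nat
      exact ⟨b0, tendsto_nhds_unique h8 h9⟩
  rw [heq]
  exact isClosed_closure.isGδ.inter (IsGδ.iInter_of_isOpen hWo)

theorem locallyWeightLT_of_thin {W : Type u} [TopologicalSpace W] {h : W → ℕ → I}
    (hh : IsEmbedding h) {A : Set (ℕ → I)} (hA : ∀ w, h w ∈ A)
    (hthin : ∀ x ∈ A, ∃ m, Thin k (A ∩ cy x m)) : LocallyWeightLT W k := by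
  intro w
  obtain ⟨m, hm⟩ := hthin (h w) (hA w)
  refine ⟨h ⁻¹' cy (h w) m,
    ((isOpen_cy _ _).preimage hh.continuous).mem_nhds (self_mem_cy _ _), ?_⟩
  set ψ : ↥(h ⁻¹' cy (h w) m) → ℕ → I := fun v => h v.1 with hψ
  have hψe : IsEmbedding ψ := hh.comp IsEmbedding.subtypeVal
  refine ⟨(fun c => ψ ⁻¹' c) '' cyls (A ∩ cy (h w) m), ?_,
    lt_of_le_of_lt Cardinal.mk_image_le hm⟩
  refine TopologicalSpace.isTopologicalBasis_of_isOpen_of_nhds ?_ ?_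
  · rintro _ ⟨_, ⟨y, -, n, rfl⟩, rfl⟩
    exact (isOpen_cy _ _).preimage hψe.continuous
  · intro v O hv hO
    obtain ⟨O', hO', rfl⟩ := hψe.isInducing.isOpen_iff.1 hO
    obtain ⟨n, hn⟩ := exists_cy_subset hO' hv
    exact ⟨_, ⟨cy (ψ v) n, ⟨ψ v, ⟨hA v.1, v.2⟩, n, rfl⟩, rfl⟩, self_mem_cy _ _,
      preimage_mono hn⟩

theorem slw_of_sm {U : Type u} [TopologicalSpace U] [TopologicalSpace.MetrizableSpace U]
    {g : U → ℕ → I} (hg : IsEmbedding g) (h : Sm k (range g)) : SLWplusGDS U k := by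
  obtain ⟨A, G, hAG, hA, hG⟩ := h
  refine ⟨g ⁻¹' (⋃ n, A n), g ⁻¹' (⋃ n, G n), ?_, ?_, ?_⟩
  · rw [← preimage_union, ← hAG]
    exact eq_univ_of_forall fun u => mem_range_self u
  · refine ⟨fun n => {a | g a.1 ∈ A n}, ?_, ?_⟩
    · refine eq_univ_of_forall fun a => ?_
      obtain ⟨n, hn⟩ := mem_iUnion.1 (show g a.1 ∈ ⋃ n, A n from a.2)
      exact mem_iUnion.2 ⟨n, hn⟩
    · intro n
      refine locallyWeightLT_of_thin (h := fun w => g w.1.1) (A := A n) ?_ (fun w => w.2) (hA n)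
      exact hg.comp (IsEmbedding.subtypeVal.comp IsEmbedding.subtypeVal)
  · refine ⟨inferInstance, ?_⟩
    intro Y _ _ φ hφ
    refine ⟨fun n => range fun b : {b : ↥(g ⁻¹' (⋃ n, G n)) // g b.1 ∈ G n} => φ b.1, ?_, ?_⟩
    · intro n
      refine isGδ_range_of_embedding
        (g := fun b : {b : ↥(g ⁻¹' (⋃ n, G n)) // g b.1 ∈ G n} => g b.1.1) ?_ ?_ ?_
      · exact hg.comp (IsEmbedding.subtypeVal.comp IsEmbedding.subtypeVal)
      · have : (range fun b : {b : ↥(g ⁻¹' (⋃ n, G n)) // g b.1 ∈ G n} => g b.1.1) = G n := by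
          apply Subset.antisymm
          · rintro _ ⟨b, rfl⟩
            exact b.2
          · intro x hx
            have h1 : x ∈ range g := by
              rw [hAG]
              exact Or.inr (mem_iUnion.2 ⟨n, hx⟩)
            obtain ⟨u, rfl⟩ := h1
            exact ⟨⟨⟨u, mem_iUnion.2 ⟨n, hx⟩⟩, hx⟩, rfl⟩
        rw [this]
        exact hG n
      · exact hφ.comp IsEmbedding.subtypeVal
    · apply Subset.antisymm
      · rintro _ ⟨b, rfl⟩
        obtain ⟨n, hn⟩ := mem_iUnion.1 b.2
        exact mem_iUnion.2 ⟨n, ⟨b, hn⟩, rfl⟩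
      · intro y hy
        obtain ⟨n, b, rfl⟩ := mem_iUnion.1 hy
        exact ⟨b.1, rfl⟩

theorem exists_lc {X : Type u} [MetricSpace X] (hind : StronglyZeroDim X) {ε : ℝ} (hε : 0 < ε) :
    ∃ p : X → X, IsLocallyConstant p ∧ ∀ x, dist x (p x) < ε := by
  classical
  obtain ⟨v, v1, v2, v3, v4⟩ := precise_refinement (fun x : X => Metric.ball x ε)
    (fun x => Metric.isOpen_ball)
    (eq_univ_of_forall fun x => mem_iUnion.2 ⟨x, Metric.mem_ball_self hε⟩)
  obtain ⟨w, w1, w2, w3⟩ := exists_iUnion_eq_closed_subset v1 (fun x => v3.point_finite x) v2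
  have hW : ∀ i, ∃ W : Set X, IsClopen W ∧ w i ⊆ W ∧ W ⊆ v i := by
    intro i
    obtain ⟨U, hU, hU1, hU2⟩ := hind (w i) (v i)ᶜ (w2 i) (v1 i).isClosed_compl
      (disjoint_compl_right_iff_subset.2 (w3 i))
    exact ⟨U, hU, hU1, disjoint_compl_left_iff_subset.1 hU2⟩
  choose W W1 W2 W3 using hW
  have hcov : ∀ x, ∃ i, x ∈ W i := by
    intro x
    obtain ⟨i, hi⟩ := mem_iUnion.1 (w1.symm ▸ mem_univ x : x ∈ ⋃ i, w i)
    exact ⟨i, W2 i hi⟩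
  rcases isEmpty_or_nonempty X with hE | hne
  · exact ⟨id, fun s => by
      rw [Set.eq_empty_of_isEmpty (id ⁻¹' s)]; exact isOpen_empty, fun x => (hE.false x).elim⟩
  have hsel : ∀ S : Set X, ∃ i, S.Nonempty → i ∈ S := by
    intro S
    by_cases h : S.Nonempty
    · exact ⟨h.some, fun _ => h.some_mem⟩
    · exact ⟨Classical.arbitrary X, fun h' => absurd h' h⟩
  choose sel hsel using hsel
  refine ⟨fun x => sel {i | x ∈ W i}, ?_, ?_⟩
  · rw [IsLocallyConstant.iff_eventually_eq]
    intro x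
    obtain ⟨t, ht, hfin⟩ := v3 x
    have h1 : ∀ᶠ y in 𝓝 x, ∀ i ∈ {i | (v i ∩ t).Nonempty}, (y ∈ W i ↔ x ∈ W i) := by
      rw [hfin.eventually_all]
      intro i _
      by_cases hx : x ∈ W i
      · filter_upwards [(W1 i).isOpen.mem_nhds hx] with y hy
        exact ⟨fun _ => hx, fun _ => hy⟩
      · filter_upwards [(W1 i).isClosed.isOpen_compl.mem_nhds hx] with y hy
        exact ⟨fun h => absurd h hy, fun h => absurd h hx⟩
    filter_upwards [h1, ht] with y hy hyt
    congr 1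
    ext i
    by_cases hi : (v i ∩ t).Nonempty
    · exact hy i hi
    · exact ⟨fun h => absurd ⟨y, W3 i h, hyt⟩ hi,
        fun h => absurd ⟨x, W3 i h, mem_of_mem_nhds ht⟩ hi⟩
  · intro x
    have h1 : x ∈ W (sel {i | x ∈ W i}) := hsel {i | x ∈ W i} (hcov x)
    exact v4 _ (W3 _ h1)

theorem exists_embedding {X : Type u} [TopologicalSpace X] [TopologicalSpace.MetrizableSpace X]
    (hind : StronglyZeroDim X) : ∃ f : X → ℕ → DiscT (Cardinal.mk X), IsEmbedding f := by
  let _ : MetricSpace X := TopologicalSpace.metrizableSpaceMetric X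
  have h := fun n : ℕ => exists_lc (X := X) hind (ε := 1 / ((n : ℝ) + 1)) (by positivity)
  choose p p1 p2 using h
  let e : X ≃ DiscT (Cardinal.mk X) := Cardinal.outMkEquiv.symm
  let f : X → ℕ → DiscT (Cardinal.mk X) := fun x n => e (p n x)
  have hf : Continuous f := continuous_pi fun n => ((p1 n).comp e).continuous
  have hnear : ∀ x y n, f y ∈ cy (f x) (n + 1) → dist y x < 2 * (1 / ((n : ℝ) + 1)) := by
    intro x y n hxy
    have h1 : p n y = p n x := e.injective (hxy n (Nat.lt_succ_self n))
    calc dist y x ≤ dist y (p n y) + dist (p n y) x := dist_triangle _ _ _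
      _ < 1 / ((n : ℝ) + 1) + 1 / ((n : ℝ) + 1) := by
        refine add_lt_add (p2 n y) ?_
        rw [h1, dist_comm]
        exact p2 n x
      _ = 2 * (1 / ((n : ℝ) + 1)) := by ring
  have hsmall : ∀ ε > 0, ∃ n : ℕ, 2 * (1 / ((n : ℝ) + 1)) < ε := by
    intro ε hε
    obtain ⟨n, hn⟩ := exists_nat_one_div_lt (half_pos hε)
    exact ⟨n, by linarith⟩
  refine ⟨f, IsEmbedding.mk (isInducing_iff_nhds.2 fun x =>
    le_antisymm (hf.tendsto x).le_comap ?_) ?_⟩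
  · intro O hO
    obtain ⟨ε, hε, hεO⟩ := Metric.mem_nhds_iff.1 hO
    obtain ⟨n, hn⟩ := hsmall ε hε
    refine mem_comap.2 ⟨cy (f x) (n + 1), (isOpen_cy _ _).mem_nhds (self_mem_cy _ _), ?_⟩
    intro y hy
    exact hεO ((hnear x y n hy).trans hn)
  · intro x y hxy
    by_contra hne
    obtain ⟨n, hn⟩ := hsmall (dist x y) (dist_pos.2 hne)
    exact absurd (hnear y x n (hxy ▸ self_mem_cy _ _)) (not_lt.2 hn.le)

end QKO

set_option linter.unusedSectionVars false

namespace QKO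

theorem exists_basis {X : Type u} [TopologicalSpace X] {k : Cardinal.{u}}
    (hw : topWeight X = k) :
    ∃ B : Set (Set X), TopologicalSpace.IsTopologicalBasis B ∧ Cardinal.mk B = k := by
  have : Nonempty {B : Set (Set X) // TopologicalSpace.IsTopologicalBasis B} :=
    ⟨⟨_, TopologicalSpace.isTopologicalBasis_opens⟩⟩
  obtain ⟨B, hB⟩ := ciInf_mem
    (fun B : {B : Set (Set X) // TopologicalSpace.IsTopologicalBasis B} => Cardinal.mk B.1)
  exact ⟨B.1, B.2, hB.trans hw⟩

theorem exists_fsd {K : Type u} [TopologicalSpace K] {S : Set K} (h : IsFsigmaDelta S) :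
    ∃ F : ℕ → ℕ → Set K, (∀ i m, IsClosed (F i m)) ∧ (∀ i, Monotone (F i)) ∧
      ∀ x, x ∈ S ↔ ∀ i, ∃ m, x ∈ F i m := by
  obtain ⟨G, hG, rfl⟩ := h
  choose H hH hH' using hG
  refine ⟨fun i m => ⋃ l ∈ Finset.range (m + 1), H i l,
    fun i m => isClosed_biUnion_finset fun l _ => hH i l, ?_, ?_⟩
  · intro i m m' hm x hx
    simp only [mem_iUnion, Finset.mem_range] at hx ⊢
    obtain ⟨l, hl, hx⟩ := hx
    exact ⟨l, by omega, hx⟩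
  · intro x
    simp only [mem_iInter, hH', mem_iUnion, Finset.mem_range]
    refine forall_congr' fun i => ⟨?_, ?_⟩
    · rintro ⟨l, hl⟩
      exact ⟨l, l, by omega, hl⟩
    · rintro ⟨m, l, -, hl⟩
      exact ⟨l, hl⟩

theorem exists_dense_seq {X : Type u} [TopologicalSpace X] [Nonempty X] (h : FirstCategory X) :
    ∃ P : ℕ → Set X, (∀ n, IsOpen (P n)) ∧ (∀ n, Dense (P n)) ∧ Antitone P ∧
      ∀ x, ∃ n, x ∉ P n := by
  unfold FirstCategory IsMeagre at h
  rw [compl_univ, mem_residual_iff] at h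
  obtain ⟨S, S1, S2, S3, S4⟩ := h
  have hSne : S.Nonempty := by
    by_contra hcon
    rw [not_nonempty_iff_eq_empty] at hcon
    subst hcon
    rw [sInter_empty] at S4
    exact S4 (mem_univ (Classical.arbitrary X))
  obtain ⟨O, rfl⟩ := S3.exists_eq_range hSne
  have hP : ∀ n, IsOpen (⋂ l ∈ Finset.range (n + 1), O l) ∧
      Dense (⋂ l ∈ Finset.range (n + 1), O l) := by
    intro n
    induction n with
    | zero => simpa using ⟨S1 _ (mem_range_self 0), S2 _ (mem_range_self 0)⟩
    | succ n ih =>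
      rw [Finset.range_add_one, Finset.set_biInter_insert]
      exact ⟨(S1 _ (mem_range_self _)).inter ih.1,
        (S2 _ (mem_range_self _)).inter_of_isOpen_left ih.2 (S1 _ (mem_range_self _))⟩
  refine ⟨fun n => ⋂ l ∈ Finset.range (n + 1), O l, fun n => (hP n).1, fun n => (hP n).2,
    ?_, ?_⟩
  · intro n m hnm x hx
    simp only [mem_iInter, Finset.mem_range] at hx ⊢
    intro l hl
    exact hx l (by omega)
  · intro x
    by_contra hcon
    push Not at hcon
    refine S4 (a := x) ?_
    rintro _ ⟨n, rfl⟩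
    have := hcon n
    simp only [mem_iInter, Finset.mem_range] at this
    exact this n (by omega)

theorem final (k : Cardinal.{u}) (hk : Cardinal.aleph0 ≤ k)
    (X : Type u) [TopologicalSpace X]
    (habs : AbsFsigmaDelta X) (hcat : FirstCategory X)
    (hind : StronglyZeroDim X) (hnw : NowhereSLWplusGDS X k)
    (hw : topWeight X = k) :
    Nonempty (X ≃ₜ QkOmega k) := by
  have hmet : TopologicalSpace.MetrizableSpace X := habs.1
  obtain ⟨B, hB, hBk⟩ := exists_basis hw
  have hne : Nonempty X := by
    by_contra hcon
    rw [not_nonempty_iff] at hcon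
    have h1 : Cardinal.mk B < Cardinal.aleph0 := Cardinal.lt_aleph0_of_finite B
    rw [hBk] at h1
    exact absurd hk (not_le.2 h1)
  obtain ⟨f, hf⟩ := exists_embedding hind
  obtain ⟨F, F1, F2, F3⟩ := exists_fsd (habs.2 _ f hf)
  obtain ⟨P, P1, P2, P3, P4⟩ := exists_dense_seq hcat
  have hext : Ext k (range f) := by
    intro β p hp
    rw [← hBk]
    have h1 : ∀ c : p '' range f, ∃ x b, p (f x) = c ∧ b ∈ B ∧ x ∈ b ∧ ∀ y ∈ b, p (f y) = c := by
      rintro ⟨_, _, ⟨x, rfl⟩, rfl⟩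
      obtain ⟨m, hm⟩ := hp (f x) (mem_range_self x)
      obtain ⟨b, hb, hxb, hbs⟩ := hB.exists_subset_of_mem_open (self_mem_cy (f x) m)
        ((isOpen_cy (f x) m).preimage hf.continuous)
      exact ⟨x, b, rfl, hb, hxb, fun y hy => hm _ (mem_range_self y) (hbs hy)⟩
    choose x b hx hb hxb hy using h1
    refine Cardinal.mk_le_of_injective (f := fun c => (⟨b c, hb c⟩ : B)) ?_
    intro c d hcd
    have h2 : b c = b d := congrArg Subtype.val hcd
    apply Subtype.ext
    rw [← hx c]
    exact hy d _ (h2 ▸ hxb c)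
  have hgood : Good k (range f) (range f) (fun m => closure (f '' (P m)ᶜ)) := by
    refine ⟨subset_rfl, range_nonempty f, fun x hx _ => hx, ?_, fun _ => isClosed_closure, ?_,
      ?_, ?_⟩
    · rintro _ ⟨x, rfl⟩ n hsm
      refine hnw (f ⁻¹' cy (f x) n) ((isOpen_cy _ _).preimage hf.continuous)
        ⟨x, self_mem_cy _ _⟩ ?_
      refine slw_of_sm (g := fun u => f u.1) (hf.comp IsEmbedding.subtypeVal) ?_
      have : (range fun u : ↥(f ⁻¹' cy (f x) n) => f u.1) = range f ∩ cy (f x) n := by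
        ext y
        constructor
        · rintro ⟨u, rfl⟩
          exact ⟨mem_range_self _, u.2⟩
        · rintro ⟨⟨u, rfl⟩, hu⟩
          exact ⟨⟨u, hu⟩, rfl⟩
      rw [this]
      exact hsm
    · intro m m' hm
      exact closure_mono (image_mono (compl_subset_compl.2 (P3 hm)))
    · rintro _ ⟨x, rfl⟩
      obtain ⟨n, hn⟩ := P4 x
      exact ⟨n, subset_closure ⟨x, hn, rfl⟩⟩
    · rintro m _ ⟨x, rfl⟩ n
      obtain ⟨y, hy, hyP⟩ := (P2 m).inter_open_nonempty _
        ((isOpen_cy (f x) n).preimage hf.continuous) ⟨x, self_mem_cy _ _⟩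
      refine ⟨f y, mem_range_self y, hy, fun hcl => ?_⟩
      have h1 : y ∈ f ⁻¹' closure (f '' (P m)ᶜ) := hcl
      rw [← hf.closure_eq_preimage_closure_image, (P1 m).isClosed_compl.closure_eq] at h1
      exact h1 hyP
  obtain ⟨e⟩ := homeo_embedded hk hext F1 F2 F3 hgood
  exact ⟨hf.toHomeomorph.trans e⟩

end QKO

/-- Theorem `t-qR`: a topological characterization of `Q(k)^ω`. -/
theorem stmt_8 (k : Cardinal.{u}) (hk : Cardinal.aleph0 ≤ k)
    (X : Type u) [TopologicalSpace X]
    (habs : AbsFsigmaDelta X) (hcat : FirstCategory X)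
    (hind : StronglyZeroDim X) (hnw : NowhereSLWplusGDS X k)
    (hw : topWeight X = k) :
    Nonempty (X ≃ₜ QkOmega k) := by
  exact QKO.final k hk X habs hcat hind hnw hw
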